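/- Let $T\subset\mathbb R^d$ be compact, $\mu$ a finite Borel measure on $T$, $p\in\mathbb N$ with $p\ge 1$, and let $X=(X_t)_{t\in T}$ and $Y=(Y_t)_{t\in T}$ be (jointly) measurable real-valued stochastic processes on a probability space with $\int_T\mathbb E[|X_t|^p]\,\mu(dt)<\infty$ and $\int_T\mathbb E[|Y_t|^p]\,\mu(dt)<\infty$, viewed as random variables in $L^p(T)=L^p(T,\mathcal B(T),\mu;\mathbb R)$. Notation. $\mathbb W_p$ is the $p$-Wasserstein distance, $\mathbb W_p(\nu^1,\nu^2)=\inf_\rho(\int\|x-y\|^p\,\rho(dx,dy))^{1/p}$ over all couplings $\rho$ of $\nu^1,\nu^2$; $\mathbb W_p(X,Y)$ refers to the laws of $X,Y$ on $L^p(T)$ and $\mathbb W_p(X_t,Y_t)$ to the laws on $\mathbb R$; $F_Z$ is the distribution function of a real random variable $Z$ and $F_Z^{[-1]}(u)=\inf\{x\in\mathbb R:F_Z(x)\ge u\}$. A copula measure on $\mathbb R^T$ is a probability measure $C$ on the product $\sigma$-algebra whose one-dimensional marginals are uniform on $[0,1]$; a copula process is a family $U=(U_t)_{t\in T}$ of random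 variables whose law on $\mathbb R^T$ is a copula measure. $C$ is an underlying path copula of a process $Z$ if $F_{C_J}((F_{Z_j}(x_j))_{j\in J})=\mathbb P(Z_j\le x_j\ \forall j\in J)$ for all finite $J\subset T$ and all $x\in\mathbb R^J$. We say that $X$ and $Y$ share the path copula $C$ if there are measurable processes $X',Y'$ on the same probability space, representing the same random elements of $L^p(T)$ as $X$ and $Y$ (almost surely $X'_t=X_t$ and $Y'_t=Y_t$ for $\mu$-almost every $t$), both having $C$ as an underlying path copula. For a copula process $U$, $F_X^{[-1]}(U)=(F_{X_t}^{[-1]}(U_t))_{t\in T}$ is regarded as a random element of $L^p(T)$ through a measurable version, i.e. a measurable process $V$ such that for $\mu$-almost every $t$, $V_t=F_{X_t}^{[-1]}(U_t)$ almost surely (any two versions give almost surely the same element of $L^p(T)$); likewise for $Y$. Consider the statements (i) $X$ and $Y$ share the path copula $C$; (ii) for a copula process $U$ with law $C$, the processes $F_X^{[-1]}(U)$ and $F_Y^{[-1]}(U)$ have measurable versions, and the pair $(F_X^{[-1]}(U),F_Y^{[-1]}(U))$ is an optimal coupling of $X$ and $Y$ for the $p$-Wasserstein distance on $L^p(T)$;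 (iii) $\mathbb W_p^p(X,Y)=\int_T\mathbb W_p^p(X_t,Y_t)\,\mu(dt)$. Then for every copula measure $C$ on $\mathbb R^T$ and every copula process $U$ with law $C$, (i) and (ii) are equivalent. If (i) holds for some copula measure $C$, then (iii) holds. If $p\ge 2$, then conversely (iii) implies that (i) holds for some copula measure $C$. Moreover, if (i), equivalently (ii), holds for $C$ and $U$ is a copula process with law $C$, then $$\int_T\mathbb W_p^p(X_t,Y_t)\,\mu(dt)=\mathbb E\big[\|F_X^{[-1]}(U)-F_Y^{[-1]}(U)\|_{L^p(T)}^p\big].$$ -/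

import Mathlib

open MeasureTheory ProbabilityTheory
open scoped ENNReal

/-- The uniform probability measure on `[0,1]`. -/
noncomputable def unif01 : Measure ℝ := (volume : Measure ℝ).restrict (Set.Icc 0 1)

/-- A copula measure on `ℝ^T`: a probability measure on the product `σ`-algebra with uniform
`[0,1]` marginals. -/
def IsCopulaMeasure {T : Type*} (C : Measure (T → ℝ)) : Prop :=
  IsProbabilityMeasure C ∧ ∀ t : T, C.map (fun u => u t) = unif01

/-- The law on `ℝ^T` (product `σ`-algebra) of a process `X = (X_t)_{t ∈ T}`. -/
noncomputable def pathLaw {T Ω : Type*} [MeasurableSpace Ω] (P : Measure Ω) (X : T → Ω → ℝ) :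
    Measure (T → ℝ) :=
  P.map (fun ω t => X t ω)

/-- A copula process: a family of random variables whose law on `ℝ^T` is a copula measure. -/
def IsCopulaProcess {T Ω : Type*} [MeasurableSpace Ω] (P : Measure Ω) (U : T → Ω → ℝ) : Prop :=
  (∀ t, Measurable (U t)) ∧ IsCopulaMeasure (pathLaw P U)

/-- `C` is an underlying copula measure of the law `ν` on `ℝ^T`: the Sklar relation
`F_{C_J}((F_{ν_j}(x_j))_{j ∈ J}) = F_{ν_J}((x_j)_{j ∈ J})` for all finite `J ⊆ T`. -/
def SklarRel {T : Type*} (C ν : Measure (T → ℝ)) : Prop :=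
  ∀ (J : Finset T) (x : T → ℝ),
    C {u | ∀ j ∈ J, u j ≤ cdf (ν.map (fun v => v j)) (x j)} =
      ν {v | ∀ j ∈ J, v j ≤ x j}

/-- The quantile function `F_ν^{[-1]}(u) = inf {x : F_ν(x) ≥ u}` of a law on `ℝ`. -/
noncomputable def quantileFn (ν : Measure ℝ) (u : ℝ) : ℝ := sInf {x : ℝ | u ≤ cdf ν x}

/-- `ρ` is a coupling of `ν₁` and `ν₂`. -/
def IsCoupling {E : Type*} [MeasurableSpace E] (ν₁ ν₂ : Measure E) (ρ : Measure (E × E)) : Prop :=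
  ρ.map Prod.fst = ν₁ ∧ ρ.map Prod.snd = ν₂

/-- The `L^p`-cost `(∫ ‖x - y‖^p ρ(dx,dy))^{1/p}` of a law `ρ` on `E × E`. -/
noncomputable def transportCost {E : Type*} [NormedAddCommGroup E] [MeasurableSpace E]
    (p : ℕ) (ρ : Measure (E × E)) : ℝ≥0∞ :=
  (∫⁻ q, ‖q.1 - q.2‖ₑ ^ p ∂ρ) ^ (1 / (p : ℝ))

/-- The `p`-Wasserstein distance of two laws on `E`. -/
noncomputable def wasserstein {E : Type*} [NormedAddCommGroup E] [MeasurableSpace E]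
    (p : ℕ) (ν₁ ν₂ : Measure E) : ℝ≥0∞ :=
  ⨅ (ρ : Measure (E × E)) (_ : IsCoupling ν₁ ν₂ ρ), transportCost p ρ

/-- `ρ` is an optimal coupling of `ν₁` and `ν₂` for the `p`-Wasserstein distance. -/
def IsOptimalCoupling {E : Type*} [NormedAddCommGroup E] [MeasurableSpace E]
    (p : ℕ) (ν₁ ν₂ : Measure E) (ρ : Measure (E × E)) : Prop :=
  IsCoupling ν₁ ν₂ ρ ∧ transportCost p ρ = wasserstein p ν₁ ν₂

/-- `L^p(T)` carries its Borel `σ`-algebra. -/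
noncomputable instance instMeasurableSpaceLpReal {T : Type*} [MeasurableSpace T] (p : ℝ≥0∞)
    [Fact (1 ≤ p)] (μ : Measure T) : MeasurableSpace (Lp ℝ p μ) := borel _

instance instBorelSpaceLpReal {T : Type*} [MeasurableSpace T] (p : ℝ≥0∞)
    [Fact (1 ≤ p)] (μ : Measure T) : BorelSpace (Lp ℝ p μ) := ⟨rfl⟩

open Classical in
/-- A process viewed as a random element of `L^p(T)`: `ω ↦ [t ↦ X_t(ω)]`, with value `0` for
those `ω` whose path is not in `ℒ^p(T)` (a null set under the moment condition). -/
noncomputable def pathClass {T Ω : Type*} [MeasurableSpace T] (p : ℕ) (μ : Measure T)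
    (X : T → Ω → ℝ) (ω : Ω) : Lp ℝ (p : ℝ≥0∞) μ :=
  if h : MemLp (fun t => X t ω) (p : ℝ≥0∞) μ then h.toLp _ else 0

/-- A measurable process: `(t, ω) ↦ X_t(ω)` is jointly measurable. -/
def MeasurableProcess {T Ω : Type*} [MeasurableSpace T] [MeasurableSpace Ω]
    (X : T → Ω → ℝ) : Prop :=
  Measurable fun q : T × Ω => X q.1 q.2

/-- The measurable process `X'` is a representative of the equivalence class of `X`: almost
surely, the paths of `X'` and `X` coincide `μ`-almost everywhere. -/
def IsRepresentative {T Ω : Type*} [MeasurableSpace T] [MeasurableSpace Ω] (μ : Measure T)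
    (P : Measure Ω) (X X' : T → Ω → ℝ) : Prop :=
  MeasurableProcess X' ∧ ∀ᵐ ω ∂P, (fun t => X' t ω) =ᵐ[μ] (fun t => X t ω)

/-- `X` and `Y`, as random elements of `L^p(T)`, share the underlying path copula `C`: there are
representatives of their equivalence classes whose laws on `ℝ^T` both have `C` as underlying
copula measure. -/
def SharePathCopula {T Ω : Type*} [MeasurableSpace T] [MeasurableSpace Ω] (μ : Measure T)
    (P : Measure Ω) (X Y : T → Ω → ℝ) (C : Measure (T → ℝ)) : Prop :=
  ∃ X' Y' : T → Ω → ℝ, IsRepresentative μ P X X' ∧ IsRepresentative μ P Y Y' ∧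
    SklarRel C (pathLaw P X') ∧ SklarRel C (pathLaw P Y')

/-- `V` is a measurable version of the process `F_X^{[-1]}(U) = (F_{X_t}^{[-1]}(U_t))_{t ∈ T}`.
Any two versions coincide `μ ⊗ P'`-almost everywhere, so they define the same random element of
`L^p(T)`; if `U` is a measurable process, then `F_X^{[-1]}(U)` is a version of itself. -/
def IsQuantileVersion {T Ω Ω' : Type*} [MeasurableSpace T] [MeasurableSpace Ω]
    [MeasurableSpace Ω'] (μ : Measure T) (P : Measure Ω) (P' : Measure Ω')
    (X : T → Ω → ℝ) (U V : T → Ω' → ℝ) : Prop :=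
  MeasurableProcess V ∧
    ∀ᵐ t ∂μ, ∀ᵐ ω ∂P', V t ω = quantileFn (P.map (X t)) (U t ω)

/-- `(F_X^{[-1]}(U), F_Y^{[-1]}(U))` is an optimal coupling of `X` and `Y` for the
`p`-Wasserstein distance on `L^p(T)`. -/
def QuantileCouplingOptimal {T Ω Ω' : Type*} [MeasurableSpace T] [MeasurableSpace Ω]
    [MeasurableSpace Ω'] (p : ℕ) [Fact (1 ≤ (p : ℝ≥0∞))] (μ : Measure T) (P : Measure Ω)
    (P' : Measure Ω') (X Y : T → Ω → ℝ) (U : T → Ω' → ℝ) : Prop :=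
  ∃ V W : T → Ω' → ℝ, IsQuantileVersion μ P P' X U V ∧ IsQuantileVersion μ P P' Y U W ∧
    IsOptimalCoupling p (P.map (pathClass p μ X)) (P.map (pathClass p μ Y))
      (P'.map fun ω => (pathClass p μ V ω, pathClass p μ W ω))

/-- `𝕎_p^p(X,Y) = ∫_T 𝕎_p^p(X_t,Y_t) μ(dt)`, with the left-hand distance on `L^p(T)` and the
right-hand ones on `ℝ`. -/
def WassersteinIntegralFormula {T Ω : Type*} [MeasurableSpace T] [MeasurableSpace Ω] (p : ℕ)
    [Fact (1 ≤ (p : ℝ≥0∞))] (μ : Measure T) (P : Measure Ω) (X Y : T → Ω → ℝ) : Prop :=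
  wasserstein p (P.map (pathClass p μ X)) (P.map (pathClass p μ Y)) ^ p =
    ∫⁻ t, wasserstein p (P.map (X t)) (P.map (Y t)) ^ p ∂μ

instance unif01.instIsProbabilityMeasure : IsProbabilityMeasure unif01 :=
  ⟨by simp [unif01]⟩

theorem ae_unif01_mem_Ioo : ∀ᵐ u ∂unif01, u ∈ Set.Ioo (0 : ℝ) 1 := by
  have h : unif01 = (volume : Measure ℝ).restrict (Set.Ioo 0 1) :=
    Measure.restrict_congr_set Ioo_ae_eq_Icc.symm
  rw [h]
  exact ae_restrict_mem measurableSet_Ioo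

/-- Galois connection between the quantile function and the distribution function. -/
theorem quantileFn_le_iff (ν : Measure ℝ) {u : ℝ} (hu : u ∈ Set.Ioo (0 : ℝ) 1) (x : ℝ) :
    quantileFn ν u ≤ x ↔ u ≤ cdf ν x := by
  have hne : {x : ℝ | u ≤ cdf ν x}.Nonempty :=
    ((tendsto_cdf_atTop ν).eventually (lt_mem_nhds hu.2)).exists.imp fun x hx => hx.le
  obtain ⟨b, hb⟩ := ((tendsto_cdf_atBot ν).eventually (gt_mem_nhds hu.1)).exists
  have hbdd : BddBelow {x : ℝ | u ≤ cdf ν x} := by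
    refine ⟨b, fun x hx => ?_⟩
    by_contra! h
    exact absurd (hx.trans (monotone_cdf ν h.le)) (not_le.2 hb)
  constructor
  · intro h
    have hgt : ∀ y, x < y → u ≤ cdf ν y := fun y hy => by
      obtain ⟨z, hz, hzy⟩ := exists_lt_of_csInf_lt hne (h.trans_lt hy)
      exact le_trans hz (monotone_cdf ν hzy.le)
    have ht : Filter.Tendsto (cdf ν) (nhdsWithin x (Set.Ioi x)) (nhds (cdf ν x)) :=
      ((cdf ν).right_continuous x).tendsto.mono_left (nhdsWithin_mono x Set.Ioi_subset_Ici_self)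
    exact ge_of_tendsto ht (eventually_nhdsWithin_of_forall fun y hy => hgt y hy)
  · exact fun h => csInf_le hbdd h

theorem measurable_quantileFn (ν : Measure ℝ) : Measurable (quantileFn ν) := by
  have h0 : ∀ u, u ≤ 0 → quantileFn ν u = 0 := fun u hu => by
    have : {x : ℝ | u ≤ cdf ν x} = Set.univ :=
      Set.eq_univ_of_forall fun x => hu.trans (cdf_nonneg ν x)
    simp [quantileFn, this]
  have h1 : ∀ u, 1 < u → quantileFn ν u = 0 := fun u hu => by
    have : {x : ℝ | u ≤ cdf ν x} = ∅ :=
      Set.eq_empty_of_forall_notMem fun x hx => absurd ((hu.trans_le hx)) (not_lt.2 (cdf_le_one ν x))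
    simp [quantileFn, this]
  refine measurable_of_Iic fun x => ?_
  have : quantileFn ν ⁻¹' Set.Iic x = (Set.Ioo 0 1 ∩ Set.Iic (cdf ν x)) ∪
      ((Set.Iic 0 ∪ Set.Ioi 1) ∩ {_u : ℝ | (0 : ℝ) ≤ x}) ∪
      ({1} ∩ {_u : ℝ | quantileFn ν 1 ≤ x}) := by
    ext u
    simp only [Set.mem_preimage, Set.mem_Iic, Set.mem_union, Set.mem_inter_iff, Set.mem_Ioi,
      Set.mem_ofPred_eq, Set.mem_singleton_iff]
    rcases le_or_gt u 0 with h | h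
    · have h' : ¬ (u = 1) := by linarith
      simp [h0 u h, h, h', not_lt.2 h]
    · rcases lt_trichotomy u 1 with h' | h' | h'
      · simp [quantileFn_le_iff ν ⟨h, h'⟩, h, h', h'.ne, not_le.2 h, not_lt.2 h'.le]
      · subst h'
        simp
      · simp [h1 u h', h', h'.ne', not_le.2 h, not_lt.2 h'.le]
  rw [this]
  exact (((measurableSet_Ioo.inter measurableSet_Iic)).union
    ((measurableSet_Iic.union measurableSet_Ioi).inter (MeasurableSet.const _))).union
    ((measurableSet_singleton _).inter (MeasurableSet.const _))

theorem unif01_Iic {a : ℝ} (h1 : a ≤ 1) : unif01 (Set.Iic a) = ENNReal.ofReal a := by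
  have : Set.Iic a ∩ Set.Icc 0 1 = Set.Icc 0 a := by
    ext u; simp only [Set.mem_inter_iff, Set.mem_Iic, Set.mem_Icc]
    constructor
    · rintro ⟨h, h', _⟩; exact ⟨h', h⟩
    · rintro ⟨h, h'⟩; exact ⟨h', h, h'.trans h1⟩
  rw [unif01, Measure.restrict_apply measurableSet_Iic, this, Real.volume_Icc, sub_zero]

/-- The quantile transform of a uniform random variable has the prescribed law. -/
theorem map_quantileFn_unif01 (ν : Measure ℝ) [IsProbabilityMeasure ν] :
    unif01.map (quantileFn ν) = ν := by
  have := Measure.isProbabilityMeasure_map (μ := unif01) (measurable_quantileFn ν).aemeasurable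
  refine Measure.ext_of_Iic _ _ fun x => ?_
  rw [Measure.map_apply (measurable_quantileFn ν) measurableSet_Iic]
  have : quantileFn ν ⁻¹' Set.Iic x =ᵐ[unif01] Set.Iic (cdf ν x) := by
    filter_upwards [ae_unif01_mem_Ioo] with u hu
    exact propext (quantileFn_le_iff ν hu x)
  rw [measure_congr this, unif01_Iic (cdf_le_one ν x), ofReal_cdf]

theorem measurableSet_forall_le {T : Type*} (J : Finset T) (x : T → ℝ) :
    MeasurableSet {v : T → ℝ | ∀ j ∈ J, v j ≤ x j} := by
  have : {v : T → ℝ | ∀ j ∈ J, v j ≤ x j} = ⋂ j ∈ J, {v : T → ℝ | v j ≤ x j} := by ext; simp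
  rw [this]
  exact Finset.measurableSet_biInter _ fun j _ =>
    measurableSet_le (measurable_pi_apply j) measurable_const

/-- Probability measures on `ℝ^T` are determined by their finite-dimensional distribution
functions. -/
theorem measure_pi_ext_of_Iic {T : Type*} {ν₁ ν₂ : Measure (T → ℝ)} [IsProbabilityMeasure ν₁]
    [IsProbabilityMeasure ν₂]
    (h : ∀ (J : Finset T) (x : T → ℝ),
      ν₁ {v | ∀ j ∈ J, v j ≤ x j} = ν₂ {v | ∀ j ∈ J, v j ≤ x j}) : ν₁ = ν₂ := by
  classical
  refine ext_of_generate_finite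
    {S | ∃ (J : Finset T) (x : T → ℝ), S = {v | ∀ j ∈ J, v j ≤ x j}} ?_ ?_ ?_ (by simp)
  · apply le_antisymm
    · refine iSup_le fun t => ?_
      rw [← measurable_iff_comap_le]
      refine @measurable_of_Iic ℝ (T → ℝ) _ _ _ (MeasurableSpace.generateFrom _) _ _ _ _ fun a => ?_
      refine MeasurableSpace.measurableSet_generateFrom ⟨{t}, fun _ => a, ?_⟩
      ext v; simp
    · refine MeasurableSpace.generateFrom_le ?_
      rintro _ ⟨J, x, rfl⟩
      exact measurableSet_forall_le J x
  · rintro _ ⟨J, x, rfl⟩ _ ⟨K, y, rfl⟩ _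
    refine ⟨J ∪ K, fun j => if j ∈ J then if j ∈ K then min (x j) (y j) else x j else y j, ?_⟩
    ext v
    simp only [Set.mem_inter_iff, Set.mem_ofPred_eq, Finset.mem_union]
    constructor
    · rintro ⟨h1, h2⟩ j hj
      by_cases hJ : j ∈ J <;> by_cases hK : j ∈ K <;> simp_all
    · intro h
      refine ⟨fun j hj => ?_, fun j hj => ?_⟩
      · have := h j (Or.inl hj)
        by_cases hK : j ∈ K <;> simp_all
      · have := h j (Or.inr hj)
        by_cases hK : j ∈ J <;> simp_all
  · rintro _ ⟨J, x, rfl⟩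
    exact h J x

section PathLaw

variable {T Ω Ω' : Type*} [MeasurableSpace Ω] [MeasurableSpace Ω']

theorem isProbabilityMeasure_pathLaw {P : Measure Ω} [IsProbabilityMeasure P] {X : T → Ω → ℝ}
    (hX : ∀ t, Measurable (X t)) : IsProbabilityMeasure (pathLaw P X) :=
  Measure.isProbabilityMeasure_map (measurable_pi_lambda _ hX).aemeasurable

theorem pathLaw_map_eval {P : Measure Ω} {X : T → Ω → ℝ} (hX : ∀ t, Measurable (X t)) (t : T) :
    (pathLaw P X).map (fun v => v t) = P.map (X t) := by
  rw [pathLaw, Measure.map_map (measurable_pi_apply t) (measurable_pi_lambda _ hX)]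
  rfl

theorem pathLaw_apply_forall_le {P : Measure Ω} {X : T → Ω → ℝ} (hX : ∀ t, Measurable (X t))
    (J : Finset T) (x : T → ℝ) :
    pathLaw P X {v | ∀ j ∈ J, v j ≤ x j} = P {ω | ∀ j ∈ J, X j ω ≤ x j} := by
  rw [pathLaw, Measure.map_apply (measurable_pi_lambda _ hX) (measurableSet_forall_le J x)]
  rfl

/-- A modification of a process has the same law on `ℝ^T`. -/
theorem pathLaw_congr {P : Measure Ω} [IsProbabilityMeasure P] {X Y : T → Ω → ℝ}
    (hX : ∀ t, Measurable (X t)) (hY : ∀ t, Measurable (Y t)) (h : ∀ t, X t =ᵐ[P] Y t) :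
    pathLaw P X = pathLaw P Y := by
  have := isProbabilityMeasure_pathLaw (P := P) hX
  have := isProbabilityMeasure_pathLaw (P := P) hY
  refine measure_pi_ext_of_Iic fun J x => ?_
  rw [pathLaw_apply_forall_le hX, pathLaw_apply_forall_le hY]
  have hJ : ∀ᵐ ω ∂P, ∀ j ∈ J, X j ω = Y j ω := (Finset.eventually_all J).2 fun j _ => h j
  refine measure_congr ?_
  filter_upwards [hJ] with ω hω
  exact propext (forall₂_congr fun j hj => by rw [hω j hj])

theorem IsCopulaProcess.map_eq {P : Measure Ω} {U : T → Ω → ℝ} (hU : IsCopulaProcess P U) (t : T) :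
    P.map (U t) = unif01 := by
  rw [← pathLaw_map_eval hU.1 t]
  exact hU.2.2 t

theorem ae_mem_Ioo_of_map_eq_unif01 {P : Measure Ω} {U : Ω → ℝ} (hU : Measurable U)
    (h : P.map U = unif01) : ∀ᵐ ω ∂P, U ω ∈ Set.Ioo (0 : ℝ) 1 := by
  have := ae_unif01_mem_Ioo
  rw [← h] at this
  exact ae_of_ae_map hU.aemeasurable this

theorem isCopulaProcess_of_map_eq {P : Measure Ω} [IsProbabilityMeasure P] {U : T → Ω → ℝ}
    (hU : ∀ t, Measurable (U t)) (h : ∀ t, P.map (U t) = unif01) : IsCopulaProcess P U :=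
  ⟨hU, isProbabilityMeasure_pathLaw hU, fun t => (pathLaw_map_eval hU t).trans (h t)⟩

/-- A process that is, at each time, the quantile transform of a copula process has the law of
this copula process as an underlying path copula. -/
theorem sklarRel_of_ae_eq_quantileFn {P : Measure Ω} [IsProbabilityMeasure P] {U Z : T → Ω → ℝ}
    (hU : IsCopulaProcess P U) (hZ : ∀ t, Measurable (Z t))
    (h : ∀ t, ∀ᵐ ω ∂P, Z t ω = quantileFn (P.map (Z t)) (U t ω)) :
    SklarRel (pathLaw P U) (pathLaw P Z) := by
  intro J x
  rw [pathLaw_apply_forall_le hZ,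
    pathLaw_apply_forall_le hU.1 J (fun j => cdf ((pathLaw P Z).map fun v => v j) (x j))]
  have hJ : ∀ᵐ ω ∂P, ∀ j ∈ J, (Z j ω ≤ x j ↔ U j ω ≤ cdf (P.map (Z j)) (x j)) := by
    refine (Finset.eventually_all J).2 fun j _ => ?_
    filter_upwards [h j, ae_mem_Ioo_of_map_eq_unif01 (hU.1 j) (hU.map_eq j)] with ω h1 h2
    rw [← quantileFn_le_iff _ h2, ← h1]
  refine measure_congr ?_
  filter_upwards [hJ] with ω hω
  refine propext (forall₂_congr fun j hj => ?_)
  rw [hω j hj, pathLaw_map_eval hZ]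

/-- The quantile transform of a copula process realises every law with this path copula. -/
theorem SklarRel.pathLaw_quantileFn {P' : Measure Ω'} [IsProbabilityMeasure P'] {U : T → Ω' → ℝ}
    (hU : IsCopulaProcess P' U) {ν : Measure (T → ℝ)} [IsProbabilityMeasure ν]
    (h : SklarRel (pathLaw P' U) ν) :
    pathLaw P' (fun t ω => quantileFn (ν.map fun v => v t) (U t ω)) = ν := by
  have hZ : ∀ t, Measurable fun ω => quantileFn (ν.map fun v => v t) (U t ω) :=
    fun t => (measurable_quantileFn _).comp (hU.1 t)
  have := isProbabilityMeasure_pathLaw (P := P') hZ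
  refine measure_pi_ext_of_Iic fun J x => ?_
  rw [pathLaw_apply_forall_le hZ, ← h J x,
    pathLaw_apply_forall_le hU.1 J (fun j => cdf (ν.map fun v => v j) (x j))]
  have hJ : ∀ᵐ ω ∂P', ∀ j ∈ J, U j ω ∈ Set.Ioo (0 : ℝ) 1 :=
    (Finset.eventually_all J).2 fun j _ => ae_mem_Ioo_of_map_eq_unif01 (hU.1 j) (hU.map_eq j)
  refine measure_congr ?_
  filter_upwards [hJ] with ω hω
  exact propext (forall₂_congr fun j hj => quantileFn_le_iff _ (hω j hj) _)

end PathLaw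

/-- A measure `κ` on `ℝ × ℝ` with `κ {(x, y) | a ≤ x ∧ y < b} = ((b - a)⁺) ^ p`. -/
noncomputable def costMeasure (p : ℕ) : Measure (ℝ × ℝ) :=
  if p = 1 then (volume : Measure ℝ).map (fun x => (x, x)) else
    ((volume : Measure ℝ).prod volume).withDensity fun q =>
      if q.1 < q.2 then ENNReal.ofReal (p * (p - 1) * (q.2 - q.1) ^ (p - 2)) else 0

instance costMeasure.instSFinite (p : ℕ) : SFinite (costMeasure p) := by
  unfold costMeasure
  split_ifs <;> infer_instance

theorem setLIntegral_Ioo_ofReal {f : ℝ → ℝ} (hf : Continuous f) {c d : ℝ} (hcd : c ≤ d)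
    (h0 : ∀ y ∈ Set.Ioo c d, 0 ≤ f y) :
    ∫⁻ y in Set.Ioo c d, ENNReal.ofReal (f y) = ENNReal.ofReal (∫ y in c..d, f y) := by
  rw [intervalIntegral.integral_of_le hcd, ← integral_Ioc_eq_integral_Ioo.symm,
    ofReal_integral_eq_lintegral_ofReal]
  · exact (hf.continuousOn.integrableOn_Icc).mono_set Set.Ioo_subset_Icc_self
  · exact (ae_restrict_iff' measurableSet_Ioo).2 (ae_of_all _ h0)

theorem measurable_costDensity (p : ℕ) : Measurable fun q : ℝ × ℝ =>
    if q.1 < q.2 then ENNReal.ofReal (p * (p - 1) * (q.2 - q.1) ^ (p - 2)) else 0 := by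
  refine Measurable.ite (measurableSet_lt measurable_fst measurable_snd) ?_ measurable_const
  fun_prop

theorem measurableSet_le_and_lt (a b : ℝ) : MeasurableSet {q : ℝ × ℝ | a ≤ q.1 ∧ q.2 < b} :=
  (measurableSet_le measurable_const measurable_fst).inter
    (measurableSet_lt measurable_snd measurable_const)

theorem costMeasure_apply {p : ℕ} (hp : 1 ≤ p) (a b : ℝ) :
    costMeasure p {q | a ≤ q.1 ∧ q.2 < b} = ENNReal.ofReal (b - a) ^ p := by
  unfold costMeasure
  split_ifs with h1
  · subst h1
    rw [Measure.map_apply (by fun_prop) (measurableSet_le_and_lt a b), pow_one]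
    exact Real.volume_Ico
  · obtain ⟨n, rfl⟩ : ∃ n, p = n + 2 := ⟨p - 2, by omega⟩
    have hin : ∀ x : ℝ, ∫⁻ y, Set.indicator {q : ℝ × ℝ | a ≤ q.1 ∧ q.2 < b} (fun q : ℝ × ℝ =>
        if q.1 < q.2 then ENNReal.ofReal (((n + 2 : ℕ) : ℝ) * (((n + 2 : ℕ) : ℝ) - 1) *
          (q.2 - q.1) ^ (n + 2 - 2)) else 0) (x, y) =
        Set.indicator (Set.Ico a b)
          (fun x => ENNReal.ofReal ((n + 2) * (b - x) ^ (n + 1))) x := by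
      intro x
      by_cases hx : x ∈ Set.Ico a b
      · rw [Set.indicator_of_mem hx]
        have : (fun y => Set.indicator {q : ℝ × ℝ | a ≤ q.1 ∧ q.2 < b} (fun q : ℝ × ℝ =>
            if q.1 < q.2 then ENNReal.ofReal (((n + 2 : ℕ) : ℝ) * (((n + 2 : ℕ) : ℝ) - 1) *
              (q.2 - q.1) ^ (n + 2 - 2)) else 0) (x, y)) =
            Set.indicator (Set.Ioo x b)
              (fun y => ENNReal.ofReal ((n + 2) * (n + 1) * (y - x) ^ n)) := by
          ext y
          simp only [Set.indicator_apply, Set.mem_ofPred_eq, Set.mem_Ioo, hx.1, true_and]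
          by_cases h2 : y < b <;> by_cases h3 : x < y <;> simp [h2, h3]
          congr 3; ring
        rw [this, lintegral_indicator measurableSet_Ioo,
          setLIntegral_Ioo_ofReal (by fun_prop) hx.2.le]
        · congr 1
          rw [intervalIntegral.integral_const_mul,
            intervalIntegral.integral_comp_sub_right (fun y => y ^ n), integral_pow]
          field_simp
          simp
        · intro y hy
          have : 0 ≤ y - x := by linarith [hy.1]
          positivity
      · rw [Set.indicator_of_notMem hx]
        refine (lintegral_congr fun y => ?_).trans lintegral_zero
        simp only [Set.indicator_apply, Set.mem_ofPred_eq]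
        split_ifs with h2 h3
        · exact absurd ⟨h2.1, h3.trans h2.2⟩ hx
        · rfl
        · rfl
    rw [withDensity_apply _ (measurableSet_le_and_lt a b),
      ← lintegral_indicator (measurableSet_le_and_lt a b),
      lintegral_prod _ ((measurable_costDensity _).indicator
        (measurableSet_le_and_lt a b)).aemeasurable]
    simp_rw [hin]
    rw [lintegral_indicator measurableSet_Ico, ← restrict_Ioo_eq_restrict_Ico]
    rcases le_or_gt a b with hab | hab
    · rw [setLIntegral_Ioo_ofReal (by fun_prop) hab, ← ENNReal.ofReal_pow (by linarith)]
      · congr 1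
        rw [intervalIntegral.integral_const_mul,
            intervalIntegral.integral_comp_sub_left (fun y => y ^ (n + 1)), integral_pow]
        push_cast
        field_simp
        simp
        ring
      · intro y hy
        have : 0 ≤ b - y := by linarith [hy.2]
        positivity
    · rw [Set.Ioo_eq_empty (not_lt.2 hab.le), ENNReal.ofReal_of_nonpos (by linarith)]
      simp

theorem enorm_sub_pow_eq_costMeasure {p : ℕ} (hp : 1 ≤ p) (a b : ℝ) :
    ‖a - b‖ₑ ^ p = costMeasure p {q | a ≤ q.1 ∧ q.2 < b} +
      costMeasure p {q | b ≤ q.1 ∧ q.2 < a} := by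
  rw [costMeasure_apply hp, costMeasure_apply hp, ← ofReal_norm, Real.norm_eq_abs]
  have hp0 : p ≠ 0 := by omega
  rcases le_total a b with h | h
  · rw [abs_of_nonpos (by linarith), ENNReal.ofReal_of_nonpos (by linarith : a - b ≤ 0)]
    simp [hp0]
  · rw [abs_of_nonneg (by linarith), ENNReal.ofReal_of_nonpos (by linarith : b - a ≤ 0)]
    simp [hp0]

section RealTransport

variable {π : Measure (ℝ × ℝ)}

/-- The `p`-th power cost of a law on `ℝ × ℝ`, in terms of its joint distribution function. -/
theorem lintegral_enorm_sub_pow {p : ℕ} (hp : 1 ≤ p) [SFinite π] :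
    ∫⁻ z, ‖z.1 - z.2‖ₑ ^ p ∂π =
      ∫⁻ q, π {z | z.1 ≤ q.1 ∧ q.2 < z.2} + π {z | z.2 ≤ q.1 ∧ q.2 < z.1} ∂costMeasure p := by
  have hm1 : MeasurableSet {w : (ℝ × ℝ) × (ℝ × ℝ) | w.1.1 ≤ w.2.1 ∧ w.2.2 < w.1.2} :=
    (measurableSet_le (measurable_fst.comp measurable_fst)
      (measurable_fst.comp measurable_snd)).inter
      (measurableSet_lt (measurable_snd.comp measurable_snd) (measurable_snd.comp measurable_fst))
  have hm2 : MeasurableSet {w : (ℝ × ℝ) × (ℝ × ℝ) | w.1.2 ≤ w.2.1 ∧ w.2.2 < w.1.1} :=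
    (measurableSet_le (measurable_snd.comp measurable_fst)
      (measurable_fst.comp measurable_snd)).inter
      (measurableSet_lt (measurable_snd.comp measurable_snd) (measurable_fst.comp measurable_fst))
  simp_rw [enorm_sub_pow_eq_costMeasure hp]
  refine (lintegral_add_left (measurable_measure_prodMk_left hm1) _).trans
    (Eq.trans ?_ (lintegral_add_left (measurable_measure_prodMk_right hm1) _).symm)
  congr 1
  · exact (Measure.prod_apply hm1).symm.trans (Measure.prod_apply_symm hm1)
  · exact (Measure.prod_apply hm2).symm.trans (Measure.prod_apply_symm hm2)

/-- The minimal `p`-th power cost of transporting `ν₁` to `ν₂`. -/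
noncomputable def realTransportCost (p : ℕ) (ν₁ ν₂ : Measure ℝ) : ℝ≥0∞ :=
  ∫⁻ q, (ν₁ (Set.Iic q.1) - ν₂ (Set.Iic q.2)) + (ν₂ (Set.Iic q.1) - ν₁ (Set.Iic q.2))
    ∂costMeasure p

theorem measure_fst_le_and_lt_snd [IsFiniteMeasure π] (x y : ℝ) :
    π {z | z.1 ≤ x ∧ y < z.2} = π.map Prod.fst (Set.Iic x) - π (Set.Iic x ×ˢ Set.Iic y) := by
  rw [Measure.map_apply measurable_fst measurableSet_Iic, ← measure_sdiff _
    (measurableSet_Iic.prod measurableSet_Iic).nullMeasurableSet (measure_ne_top _ _)]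
  · congr 1
    ext z
    simp only [Set.mem_ofPred_eq, Set.mem_sdiff, Set.mem_preimage, Set.mem_Iic, Set.mem_prod,
      not_and, not_le]
    exact ⟨fun h => ⟨h.1, fun _ => h.2⟩, fun h => ⟨h.1, h.2 h.1⟩⟩
  · exact fun z hz => hz.1

theorem measure_snd_le_and_lt_fst [IsFiniteMeasure π] (x y : ℝ) :
    π {z | z.2 ≤ x ∧ y < z.1} = π.map Prod.snd (Set.Iic x) - π (Set.Iic y ×ˢ Set.Iic x) := by
  rw [Measure.map_apply measurable_snd measurableSet_Iic, ← measure_sdiff _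
    (measurableSet_Iic.prod measurableSet_Iic).nullMeasurableSet (measure_ne_top _ _)]
  · congr 1
    ext z
    simp only [Set.mem_ofPred_eq, Set.mem_sdiff, Set.mem_preimage, Set.mem_Iic, Set.mem_prod,
      not_and, not_le]
    exact ⟨fun h => ⟨h.1, fun h' => absurd h.2 (not_lt.2 h')⟩,
      fun h => ⟨h.1, not_le.1 fun h' => absurd (h.2 h') (not_lt.2 h.1)⟩⟩
  · exact fun z hz => hz.2

theorem measure_prod_Iic_le_snd (x y : ℝ) :
    π (Set.Iic x ×ˢ Set.Iic y) ≤ π.map Prod.snd (Set.Iic y) := by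
  rw [Measure.map_apply measurable_snd measurableSet_Iic]
  exact measure_mono fun z hz => hz.2

theorem measure_prod_Iic_le_fst (x y : ℝ) :
    π (Set.Iic x ×ˢ Set.Iic y) ≤ π.map Prod.fst (Set.Iic x) := by
  rw [Measure.map_apply measurable_fst measurableSet_Iic]
  exact measure_mono fun z hz => hz.1

theorem realTransportCost_le [IsFiniteMeasure π] {p : ℕ} (hp : 1 ≤ p) :
    realTransportCost p (π.map Prod.fst) (π.map Prod.snd) ≤ ∫⁻ z, ‖z.1 - z.2‖ₑ ^ p ∂π := by
  rw [lintegral_enorm_sub_pow hp]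
  refine lintegral_mono fun q => ?_
  simp only [measure_fst_le_and_lt_snd, measure_snd_le_and_lt_fst]
  exact add_le_add (tsub_le_tsub_left (measure_prod_Iic_le_snd _ _) _)
    (tsub_le_tsub_left (measure_prod_Iic_le_fst _ _) _)

/-- Comonotone couplings are optimal. -/
theorem lintegral_enorm_sub_pow_of_comonotone [IsFiniteMeasure π] {p : ℕ} (hp : 1 ≤ p)
    (h : ∀ x y, π (Set.Iic x ×ˢ Set.Iic y) =
      min (π.map Prod.fst (Set.Iic x)) (π.map Prod.snd (Set.Iic y))) :
    ∫⁻ z, ‖z.1 - z.2‖ₑ ^ p ∂π = realTransportCost p (π.map Prod.fst) (π.map Prod.snd) := by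
  rw [lintegral_enorm_sub_pow hp]
  refine lintegral_congr fun q => ?_
  rw [measure_fst_le_and_lt_snd, measure_snd_le_and_lt_fst, h, h, tsub_min,
    min_comm (Measure.map Prod.fst π _), tsub_min]

theorem measure_real_prod_ext {π₁ π₂ : Measure (ℝ × ℝ)} [IsProbabilityMeasure π₁]
    [IsProbabilityMeasure π₂]
    (h : ∀ x y, π₁ (Set.Iic x ×ˢ Set.Iic y) = π₂ (Set.Iic x ×ˢ Set.Iic y)) : π₁ = π₂ := by
  have hgen : MeasurableSpace.generateFrom (Set.range (Set.Iic : ℝ → Set ℝ)) = borel ℝ :=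
    (borel_eq_generateFrom_Iic ℝ).symm
  have hgen' : MeasurableSpace.generateFrom (Set.range (Set.Iic : ℝ → Set ℝ)) =
      (inferInstance : MeasurableSpace ℝ) := hgen.trans (BorelSpace.measurable_eq (α := ℝ)).symm
  have hspan : IsCountablySpanning (Set.range (Set.Iic : ℝ → Set ℝ)) := by
    refine ⟨fun n : ℕ => Set.Iic (n : ℝ), fun n => ⟨_, rfl⟩, ?_⟩
    exact Set.eq_univ_of_forall fun x => Set.mem_iUnion.2 (exists_nat_ge x)
  refine ext_of_generate_finite _ (generateFrom_eq_prod hgen' hgen' hspan hspan).symm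
    (isPiSystem_Iic.prod isPiSystem_Iic) ?_ (by simp)
  rintro _ ⟨_, ⟨x, rfl⟩, _, ⟨y, rfl⟩, rfl⟩
  exact h x y

/-- The quantile (comonotone) coupling of two laws on the real line. -/
noncomputable def quantileCoupling (ν₁ ν₂ : Measure ℝ) : Measure (ℝ × ℝ) :=
  unif01.map fun u => (quantileFn ν₁ u, quantileFn ν₂ u)

variable (ν₁ ν₂ : Measure ℝ)

theorem measurable_quantileFn_prodMk :
    Measurable fun u => (quantileFn ν₁ u, quantileFn ν₂ u) :=
  (measurable_quantileFn ν₁).prodMk (measurable_quantileFn ν₂)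

instance quantileCoupling.instIsProbabilityMeasure :
    IsProbabilityMeasure (quantileCoupling ν₁ ν₂) :=
  Measure.isProbabilityMeasure_map (measurable_quantileFn_prodMk ν₁ ν₂).aemeasurable

theorem quantileCoupling_fst [IsProbabilityMeasure ν₁] :
    (quantileCoupling ν₁ ν₂).map Prod.fst = ν₁ := by
  rw [quantileCoupling, Measure.map_map measurable_fst (measurable_quantileFn_prodMk ν₁ ν₂)]
  exact map_quantileFn_unif01 ν₁

theorem quantileCoupling_snd [IsProbabilityMeasure ν₂] :
    (quantileCoupling ν₁ ν₂).map Prod.snd = ν₂ := by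
  rw [quantileCoupling, Measure.map_map measurable_snd (measurable_quantileFn_prodMk ν₁ ν₂)]
  exact map_quantileFn_unif01 ν₂

theorem quantileCoupling_prod_Iic [IsProbabilityMeasure ν₁] [IsProbabilityMeasure ν₂] (x y : ℝ) :
    quantileCoupling ν₁ ν₂ (Set.Iic x ×ˢ Set.Iic y) = min (ν₁ (Set.Iic x)) (ν₂ (Set.Iic y)) := by
  rw [quantileCoupling, Measure.map_apply (measurable_quantileFn_prodMk ν₁ ν₂)
    (measurableSet_Iic.prod measurableSet_Iic)]
  have : (fun u => (quantileFn ν₁ u, quantileFn ν₂ u)) ⁻¹' (Set.Iic x ×ˢ Set.Iic y) =ᵐ[unif01]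
      Set.Iic (min (cdf ν₁ x) (cdf ν₂ y)) := by
    filter_upwards [ae_unif01_mem_Ioo] with u hu
    refine propext ?_
    change (quantileFn ν₁ u ≤ x ∧ quantileFn ν₂ u ≤ y) ↔ u ≤ _
    rw [quantileFn_le_iff ν₁ hu, quantileFn_le_iff ν₂ hu, le_min_iff]
  rw [measure_congr this, unif01_Iic (min_le_of_left_le (cdf_le_one _ _)), ← ofReal_cdf ν₁,
    ← ofReal_cdf ν₂, ENNReal.ofReal_min]

theorem lintegral_quantileCoupling [IsProbabilityMeasure ν₁] [IsProbabilityMeasure ν₂] {p : ℕ}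
    (hp : 1 ≤ p) :
    ∫⁻ z, ‖z.1 - z.2‖ₑ ^ p ∂quantileCoupling ν₁ ν₂ = realTransportCost p ν₁ ν₂ := by
  rw [lintegral_enorm_sub_pow_of_comonotone hp]
  · rw [quantileCoupling_fst, quantileCoupling_snd]
  · intro x y
    rw [quantileCoupling_fst, quantileCoupling_snd, quantileCoupling_prod_Iic]

theorem rpow_one_div_pow {p : ℕ} (hp : 1 ≤ p) (a : ℝ≥0∞) : (a ^ (1 / (p : ℝ))) ^ p = a := by
  have : (p : ℝ) ≠ 0 := by positivity
  rw [← ENNReal.rpow_natCast, ← ENNReal.rpow_mul, one_div, inv_mul_cancel₀ this, ENNReal.rpow_one]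

theorem wasserstein_pow_le {E : Type*} [NormedAddCommGroup E] [MeasurableSpace E] {p : ℕ}
    (hp : 1 ≤ p) {m₁ m₂ : Measure E} {ρ : Measure (E × E)} (hρ : IsCoupling m₁ m₂ ρ) :
    wasserstein p m₁ m₂ ^ p ≤ ∫⁻ q, ‖q.1 - q.2‖ₑ ^ p ∂ρ := by
  rw [← rpow_one_div_pow hp (∫⁻ q, ‖q.1 - q.2‖ₑ ^ p ∂ρ)]
  gcongr
  exact iInf₂_le ρ hρ

theorem le_wasserstein_pow {E : Type*} [NormedAddCommGroup E] [MeasurableSpace E] {p : ℕ}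
    (hp : 1 ≤ p) {m₁ m₂ : Measure E} {c : ℝ≥0∞}
    (h : ∀ ρ, IsCoupling m₁ m₂ ρ → c ≤ ∫⁻ q, ‖q.1 - q.2‖ₑ ^ p ∂ρ) :
    c ≤ wasserstein p m₁ m₂ ^ p := by
  rw [← rpow_one_div_pow hp c]
  gcongr
  exact le_iInf₂ fun ρ hρ => ENNReal.rpow_le_rpow (h ρ hρ) (by positivity)

theorem IsCoupling.isProbabilityMeasure {E : Type*} [MeasurableSpace E] {m₁ m₂ : Measure E}
    {ρ : Measure (E × E)} [IsProbabilityMeasure m₁] (hρ : IsCoupling m₁ m₂ ρ) :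
    IsProbabilityMeasure ρ := by
  refine ⟨?_⟩
  have h : ρ.map Prod.fst Set.univ = 1 := by rw [hρ.1]; exact measure_univ
  rwa [Measure.map_apply measurable_fst MeasurableSet.univ, Set.preimage_univ] at h

/-- The Wasserstein distance of two laws on the real line. -/
theorem wasserstein_pow_real [IsProbabilityMeasure ν₁] [IsProbabilityMeasure ν₂] {p : ℕ}
    (hp : 1 ≤ p) : wasserstein p ν₁ ν₂ ^ p = realTransportCost p ν₁ ν₂ := by
  apply le_antisymm
  · rw [← lintegral_quantileCoupling ν₁ ν₂ hp]
    exact wasserstein_pow_le hp ⟨quantileCoupling_fst ν₁ ν₂, quantileCoupling_snd ν₁ ν₂⟩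
  · refine le_wasserstein_pow hp fun ρ hρ => ?_
    have := hρ.isProbabilityMeasure
    have h := realTransportCost_le (π := ρ) hp
    rwa [hρ.1, hρ.2] at h

end RealTransport

section Uniqueness

variable {π : Measure (ℝ × ℝ)}

theorem measure_prod_Iic_eq_min [IsFiniteMeasure π] {x y : ℝ}
    (h : π.map Prod.fst (Set.Iic x) - π.map Prod.snd (Set.Iic y) =
      π {z | z.1 ≤ x ∧ y < z.2}) :
    π (Set.Iic x ×ˢ Set.Iic y) =
      min (π.map Prod.fst (Set.Iic x)) (π.map Prod.snd (Set.Iic y)) := by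
  rw [measure_fst_le_and_lt_snd] at h
  have h1 := measure_prod_Iic_le_fst (π := π) x y
  have h2 := measure_prod_Iic_le_snd (π := π) x y
  have hF : π.map Prod.fst (Set.Iic x) ≠ ∞ := measure_ne_top _ _
  rcases le_total (π.map Prod.fst (Set.Iic x)) (π.map Prod.snd (Set.Iic y)) with h' | h'
  · rw [min_eq_left h']
    rw [tsub_eq_zero_of_le h'] at h
    exact le_antisymm h1 (tsub_eq_zero_iff_le.1 h.symm)
  · rw [min_eq_right h', ← ENNReal.sub_sub_cancel hF h1, ← h, ENNReal.sub_sub_cancel hF h']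

theorem real_prod_Iic_le_add [IsProbabilityMeasure π] {x y x' y' : ℝ}
    (hx : x ≤ x') (hy : y ≤ y') :
    π.real (Set.Iic x' ×ˢ Set.Iic y') ≤ π.real (Set.Iic x ×ˢ Set.Iic y) +
      (cdf (π.map Prod.fst) x' - cdf (π.map Prod.fst) x) +
      (cdf (π.map Prod.snd) y' - cdf (π.map Prod.snd) y) := by
  have := Measure.isProbabilityMeasure_map (μ := π) measurable_fst.aemeasurable
  have := Measure.isProbabilityMeasure_map (μ := π) measurable_snd.aemeasurable
  have h1 : cdf (π.map Prod.fst) x' - cdf (π.map Prod.fst) x =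
      π.real (Prod.fst ⁻¹' Set.Ioc x x') := by
    rw [cdf_eq_real, cdf_eq_real, ← measureReal_sdiff (Set.Iic_subset_Iic.2 hx) measurableSet_Iic,
      Set.Iic_sdiff_Iic, map_measureReal_apply measurable_fst measurableSet_Ioc]
  have h2 : cdf (π.map Prod.snd) y' - cdf (π.map Prod.snd) y =
      π.real (Prod.snd ⁻¹' Set.Ioc y y') := by
    rw [cdf_eq_real, cdf_eq_real, ← measureReal_sdiff (Set.Iic_subset_Iic.2 hy) measurableSet_Iic,
      Set.Iic_sdiff_Iic, map_measureReal_apply measurable_snd measurableSet_Ioc]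
  rw [h1, h2]
  refine le_trans (measureReal_mono (h₂ := measure_ne_top _ _) ?_)
    (le_trans (measureReal_union_le _ _) (add_le_add (measureReal_union_le _ _) le_rfl))
  rintro ⟨a, b⟩ ⟨ha, hb⟩
  simp only [Set.mem_union, Set.mem_prod, Set.mem_Iic, Set.mem_preimage, Set.mem_Ioc] at ha hb ⊢
  by_cases h3 : a ≤ x
  · by_cases h4 : b ≤ y
    · exact Or.inl (Or.inl ⟨h3, h4⟩)
    · exact Or.inr ⟨not_le.1 h4, hb⟩
  · exact Or.inl (Or.inr ⟨not_le.1 h3, ha⟩)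

theorem prod_Iic_eq_min_of_ae [IsProbabilityMeasure π]
    (h : ∀ᵐ q ∂(volume : Measure ℝ).prod volume, q.1 < q.2 → π (Set.Iic q.1 ×ˢ Set.Iic q.2) =
      min (π.map Prod.fst (Set.Iic q.1)) (π.map Prod.snd (Set.Iic q.2)))
    {x y : ℝ} (hxy : x ≤ y) : π (Set.Iic x ×ˢ Set.Iic y) =
      min (π.map Prod.fst (Set.Iic x)) (π.map Prod.snd (Set.Iic y)) := by
  have := Measure.isProbabilityMeasure_map (μ := π) measurable_fst.aemeasurable
  have := Measure.isProbabilityMeasure_map (μ := π) measurable_snd.aemeasurable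
  refine le_antisymm (le_min (measure_prod_Iic_le_fst x y) (measure_prod_Iic_le_snd x y)) ?_
  rw [← ofReal_cdf, ← ofReal_cdf, ← ENNReal.ofReal_min, ENNReal.ofReal_le_iff_le_toReal
    (measure_ne_top _ _)]
  change _ ≤ π.real _
  set F := cdf (π.map Prod.fst)
  set G := cdf (π.map Prod.snd)
  have key : ∀ δ > 0, min (F x) (G y) ≤ π.real (Set.Iic x ×ˢ Set.Iic y) + (F (x + δ) - F x) +
      (G (y + 2 * δ) - G y) := by
    intro δ hδ
    have hpos : (volume : Measure ℝ).prod volume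
        (Set.Ioo x (x + δ) ×ˢ Set.Ioo (y + δ) (y + 2 * δ)) ≠ 0 := by
      rw [Measure.prod_prod, Real.volume_Ioo, Real.volume_Ioo]
      have h1 : 0 < x + δ - x := by linarith
      have h2 : 0 < y + 2 * δ - (y + δ) := by linarith
      exact mul_ne_zero (ENNReal.ofReal_pos.2 h1).ne' (ENNReal.ofReal_pos.2 h2).ne'
    obtain ⟨⟨x', y'⟩, ⟨hx', hy'⟩, hq⟩ :=
      ((frequently_ae_mem_iff.2 hpos).and_eventually h).exists
    simp only [Set.mem_Ioo] at hx' hy'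
    have hq := hq (by dsimp only; linarith)
    dsimp only at hq
    rw [← ofReal_cdf, ← ofReal_cdf, ← ENNReal.ofReal_min] at hq
    have hq' : π.real (Set.Iic x' ×ˢ Set.Iic y') = min (F x') (G y') := by
      rw [Measure.real, hq, ENNReal.toReal_ofReal (le_min (cdf_nonneg _ _) (cdf_nonneg _ _))]
    have h3 := real_prod_Iic_le_add (π := π) hx'.1.le (show y ≤ y' by linarith)
    have h4 : min (F x) (G y) ≤ min (F x') (G y') :=
      min_le_min (monotone_cdf _ hx'.1.le) (monotone_cdf _ (by linarith))
    have h5 : F x' ≤ F (x + δ) := monotone_cdf _ hx'.2.le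
    have h6 : G y' ≤ G (y + 2 * δ) := monotone_cdf _ hy'.2.le
    rw [hq'] at h3
    linarith
  have hcont : ∀ (K : StieltjesFunction ℝ) (a c : ℝ), 0 < c →
      Filter.Tendsto (fun δ => K (a + c * δ)) (nhdsWithin 0 (Set.Ioi 0)) (nhds (K a)) := by
    intro K a c hc
    refine (K.right_continuous a).tendsto.comp (tendsto_nhdsWithin_iff.2 ⟨?_, ?_⟩)
    · have : Filter.Tendsto (fun δ : ℝ => a + c * δ) (nhds 0) (nhds (a + c * 0)) :=
        (continuous_const.add (continuous_const.mul continuous_id)).tendsto 0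
      rw [mul_zero, add_zero] at this
      exact this.mono_left nhdsWithin_le_nhds
    · filter_upwards [self_mem_nhdsWithin] with δ hδ
      have : 0 < c * δ := mul_pos hc hδ
      simp only [Set.mem_Ici]; linarith
  have hlim : Filter.Tendsto (fun δ => π.real (Set.Iic x ×ˢ Set.Iic y) + (F (x + δ) - F x) +
      (G (y + 2 * δ) - G y)) (nhdsWithin 0 (Set.Ioi 0))
      (nhds (π.real (Set.Iic x ×ˢ Set.Iic y) + (F x - F x) + (G y - G y))) := by
    have h1 := hcont F x 1 one_pos
    have h2 := hcont G y 2 two_pos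
    simp only [one_mul] at h1
    exact (tendsto_const_nhds.add (h1.sub_const _)).add (h2.sub_const _)
  simp only [sub_self, add_zero] at hlim
  exact ge_of_tendsto hlim (by filter_upwards [self_mem_nhdsWithin] with δ hδ using key δ hδ)

theorem measurable_measure_fst_le_and_lt_snd [SFinite π] :
    Measurable fun q : ℝ × ℝ => π {z | z.1 ≤ q.1 ∧ q.2 < z.2} :=
  measurable_measure_prodMk_left (s := {w : (ℝ × ℝ) × (ℝ × ℝ) | w.2.1 ≤ w.1.1 ∧ w.1.2 < w.2.2})
    ((measurableSet_le (measurable_fst.comp measurable_snd)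
      (measurable_fst.comp measurable_fst)).inter
      (measurableSet_lt (measurable_snd.comp measurable_fst) (measurable_snd.comp measurable_snd)))

theorem measurable_measure_snd_le_and_lt_fst [SFinite π] :
    Measurable fun q : ℝ × ℝ => π {z | z.2 ≤ q.1 ∧ q.2 < z.1} :=
  measurable_measure_prodMk_left (s := {w : (ℝ × ℝ) × (ℝ × ℝ) | w.2.2 ≤ w.1.1 ∧ w.1.2 < w.2.1})
    ((measurableSet_le (measurable_snd.comp measurable_snd)
      (measurable_fst.comp measurable_fst)).inter
      (measurableSet_lt (measurable_snd.comp measurable_fst) (measurable_fst.comp measurable_snd)))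

/-- For `p ≥ 2`, the quantile coupling is the only optimal coupling on the real line. -/
theorem eq_quantileCoupling_of_optimal [IsProbabilityMeasure π] {p : ℕ} (hp : 2 ≤ p)
    (hfin : ∫⁻ z, ‖z.1 - z.2‖ₑ ^ p ∂π ≠ ∞)
    (hopt : ∫⁻ z, ‖z.1 - z.2‖ₑ ^ p ∂π ≤
      realTransportCost p (π.map Prod.fst) (π.map Prod.snd)) :
    π = quantileCoupling (π.map Prod.fst) (π.map Prod.snd) := by
  have := Measure.isProbabilityMeasure_map (μ := π) measurable_fst.aemeasurable
  have := Measure.isProbabilityMeasure_map (μ := π) measurable_snd.aemeasurable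
  have hcost := realTransportCost_le (π := π) (show 1 ≤ p by omega)
  have hfin' := ne_top_of_le_ne_top hfin hcost
  have hle1 : ∀ q : ℝ × ℝ, π.map Prod.fst (Set.Iic q.1) - π.map Prod.snd (Set.Iic q.2) ≤
      π {z | z.1 ≤ q.1 ∧ q.2 < z.2} := fun q => by
    rw [measure_fst_le_and_lt_snd]
    exact tsub_le_tsub_left (measure_prod_Iic_le_snd _ _) _
  have hle2 : ∀ q : ℝ × ℝ, π.map Prod.snd (Set.Iic q.1) - π.map Prod.fst (Set.Iic q.2) ≤
      π {z | z.2 ≤ q.1 ∧ q.2 < z.1} := fun q => by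
    rw [measure_snd_le_and_lt_fst]
    exact tsub_le_tsub_left (measure_prod_Iic_le_fst _ _) _
  rw [lintegral_enorm_sub_pow (by omega)] at hopt
  have hae := ae_eq_of_ae_le_of_lintegral_le
    (ae_of_all _ fun q => add_le_add (hle1 q) (hle2 q)) hfin'
    (measurable_measure_fst_le_and_lt_snd.add measurable_measure_snd_le_and_lt_fst).aemeasurable
    hopt
  have hae' : ∀ᵐ q ∂(volume : Measure ℝ).prod volume, q.1 < q.2 →
      (π.map Prod.fst (Set.Iic q.1) - π.map Prod.snd (Set.Iic q.2) =
        π {z | z.1 ≤ q.1 ∧ q.2 < z.2}) ∧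
      (π.map Prod.snd (Set.Iic q.1) - π.map Prod.fst (Set.Iic q.2) =
        π {z | z.2 ≤ q.1 ∧ q.2 < z.1}) := by
    rw [costMeasure, if_neg (by omega), Filter.EventuallyEq,
      ae_withDensity_iff (measurable_costDensity p)] at hae
    filter_upwards [hae] with q hq hlt
    have hq := hq (by
      rw [if_pos hlt]
      have h1 : (0 : ℝ) < q.2 - q.1 := by linarith
      have h2 : (2 : ℝ) ≤ p := by exact_mod_cast hp
      have h3 : (0 : ℝ) < p - 1 := by linarith
      exact (ENNReal.ofReal_pos.2 (by positivity)).ne')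
    have h1 : π {z | z.1 ≤ q.1 ∧ q.2 < z.2} ≠ ∞ := measure_ne_top _ _
    have h2 : π {z | z.2 ≤ q.1 ∧ q.2 < z.1} ≠ ∞ := measure_ne_top _ _
    constructor
    · refine le_antisymm (hle1 q) (not_lt.1 fun hc => hq.not_lt ?_)
      exact ENNReal.add_lt_add_of_lt_of_le (ne_top_of_le_ne_top h2 (hle2 q)) hc (hle2 q)
    · refine le_antisymm (hle2 q) (not_lt.1 fun hc => hq.not_lt ?_)
      exact ENNReal.add_lt_add_of_le_of_lt (ne_top_of_le_ne_top h1 (hle1 q)) (hle1 q) hc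
  have hswap1 : (π.map Prod.swap).map Prod.fst = π.map Prod.snd := by
    rw [Measure.map_map measurable_fst measurable_swap]; rfl
  have hswap2 : (π.map Prod.swap).map Prod.snd = π.map Prod.fst := by
    rw [Measure.map_map measurable_snd measurable_swap]; rfl
  have := Measure.isProbabilityMeasure_map (μ := π) measurable_swap.aemeasurable
  refine measure_real_prod_ext fun x y => ?_
  rw [quantileCoupling_prod_Iic]
  rcases le_total x y with hxy | hxy
  · refine prod_Iic_eq_min_of_ae ?_ hxy
    filter_upwards [hae'] with q hq hlt
    exact measure_prod_Iic_eq_min (hq hlt).1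
  · have hsw := prod_Iic_eq_min_of_ae (π := π.map Prod.swap) ?_ hxy
    · rw [hswap1, hswap2, Measure.map_apply measurable_swap
        (measurableSet_Iic.prod measurableSet_Iic), Set.preimage_swap_prod] at hsw
      rw [hsw, min_comm]
    · filter_upwards [hae'] with q hq hlt
      refine measure_prod_Iic_eq_min ?_
      rw [hswap1, hswap2, (hq hlt).2, Measure.map_apply measurable_swap]
      · rfl
      · exact (measurableSet_le measurable_fst measurable_const).inter
          (measurableSet_lt measurable_const measurable_snd)

end Uniqueness

/-- Randomisation: a real component of a joint law can be realised as a measurable function of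
the other component and an independent uniform variable. -/
theorem exists_measurable_randomization {S : Type*} [MeasurableSpace S] (θ : Measure (S × ℝ))
    [IsProbabilityMeasure θ] :
    ∃ f : S → unitInterval → ℝ, Measurable (Function.uncurry f) ∧
      (θ.fst.prod (volume : Measure unitInterval)).map (fun q => (q.1, f q.1 q.2)) = θ := by
  obtain ⟨f, hf, hfκ⟩ := Kernel.exists_measurable_map_eq_unitInterval θ.condKernel
  refine ⟨f, hf, ?_⟩
  have hm : Measurable fun q : S × unitInterval => (q.1, f q.1 q.2) := measurable_fst.prodMk hf
  conv_rhs => rw [← θ.disintegrate θ.condKernel]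
  ext A hA
  rw [Measure.map_apply hm hA, Measure.prod_apply (hm hA), Measure.compProd_apply hA]
  refine lintegral_congr fun s => ?_
  have hs : Measurable (f s) := hf.comp measurable_prodMk_left
  rw [← hfκ s, Measure.map_apply hs (measurable_prodMk_left hA)]
  rfl

section LpValued

variable {S A : Type*} [MeasurableSpace S] [MeasurableSpace A] {m : Measure A} {p : ℝ≥0∞}
  [Fact (1 ≤ p)]

theorem stronglyMeasurable_indicatorConstLp_section [IsFiniteMeasure m] (hp : p ≠ ∞) (c : ℝ)
    {B : Set (S × A)} (hB : MeasurableSet B) :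
    StronglyMeasurable fun s : S => indicatorConstLp p (μ := m)
      (measurable_prodMk_left (x := s) hB) (measure_ne_top m _) c := by
  induction B, hB using MeasurableSpace.induction_on_inter generateFrom_prod.symm
    isPiSystem_prod with
  | empty =>
    have : (fun s : S => indicatorConstLp p (μ := m)
        (measurable_prodMk_left (x := s) MeasurableSet.empty) (measure_ne_top m _) c) =
        fun _ => 0 := funext fun s => indicatorConstLp_empty
    rw [this]
    exact stronglyMeasurable_const
  | basic t ht =>
    obtain ⟨B₁, hB₁, B₂, hB₂, rfl⟩ := ht
    have : (fun s : S => indicatorConstLp p (μ := m)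
        (measurable_prodMk_left (x := s) (hB₁.prod hB₂)) (measure_ne_top m _) c) =
        B₁.indicator fun _ => indicatorConstLp p hB₂ (measure_ne_top m _) c := by
      ext1 s
      by_cases hs : s ∈ B₁
      · rw [Set.indicator_of_mem hs]
        simp only [Set.mk_preimage_prod_right hs]
      · rw [Set.indicator_of_notMem hs]
        simp only [Set.mk_preimage_prod_right_eq_empty hs]
        exact indicatorConstLp_empty
    exact this ▸ stronglyMeasurable_const.indicator hB₁
  | compl t ht ih =>
    have : (fun s : S => indicatorConstLp p (μ := m)
        (measurable_prodMk_left (x := s) ht.compl) (measure_ne_top m _) c) =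
        fun s => indicatorConstLp p MeasurableSet.univ (measure_ne_top m _) c -
          indicatorConstLp p (measurable_prodMk_left (x := s) ht) (measure_ne_top m _) c := by
      ext1 s
      rw [eq_sub_iff_add_eq, ← indicatorConstLp_disjoint_union]
      · simp only [Set.preimage_compl, Set.compl_union_self]
      · rw [Set.preimage_compl]
        exact disjoint_compl_left
    exact this ▸ stronglyMeasurable_const.sub ih
  | iUnion f hd hm ih =>
    have hfin : ∀ n, MeasurableSet (⋃ i ∈ Finset.range n, f i) := fun n =>
      Finset.measurableSet_biUnion _ fun i _ => hm i
    have hpart : ∀ n, StronglyMeasurable fun s : S => indicatorConstLp p (μ := m)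
        (measurable_prodMk_left (x := s) (hfin n)) (measure_ne_top m _) c := by
      intro n
      induction n with
      | zero =>
        have : (fun s : S => indicatorConstLp p (μ := m)
            (measurable_prodMk_left (x := s) (hfin 0)) (measure_ne_top m _) c) =
            fun _ => 0 := by
          ext1 s
          simp only [Finset.range_zero, Finset.notMem_empty, Set.iUnion_of_empty, Set.iUnion_empty,
            Set.preimage_empty]
          exact indicatorConstLp_empty
        rw [this]
        exact stronglyMeasurable_const
      | succ n ihn =>
        have : (fun s : S => indicatorConstLp p (μ := m)
            (measurable_prodMk_left (x := s) (hfin (n + 1))) (measure_ne_top m _) c) =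
            fun s => indicatorConstLp p (measurable_prodMk_left (x := s) (hm n))
              (measure_ne_top m _) c +
            indicatorConstLp p (measurable_prodMk_left (x := s) (hfin n)) (measure_ne_top m _) c := by
          ext1 s
          rw [← indicatorConstLp_disjoint_union]
          · simp only [Finset.range_add_one, Finset.set_biUnion_insert, Set.preimage_union]
          · refine Disjoint.preimage _ ?_
            simp only [Set.disjoint_iUnion_right]
            intro i hi
            exact hd (Finset.mem_range.1 hi).ne'
        exact this ▸ (ih n).add ihn
    refine stronglyMeasurable_of_tendsto Filter.atTop hpart (tendsto_pi_nhds.2 fun s => ?_)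
    refine tendsto_indicatorConstLp_set hp ?_
    have hsub : ∀ n, symmDiff (Prod.mk s ⁻¹' ⋃ i ∈ Finset.range n, f i) (Prod.mk s ⁻¹' ⋃ i, f i) =
        (Prod.mk s ⁻¹' ⋃ i, f i) \ (Prod.mk s ⁻¹' ⋃ i ∈ Finset.range n, f i) := fun n =>
      symmDiff_of_le (Set.preimage_mono (Set.iUnion₂_subset fun i _ => Set.subset_iUnion f i))
    simp_rw [hsub]
    have hanti : Antitone fun n => (Prod.mk s ⁻¹' ⋃ i, f i) \
        (Prod.mk s ⁻¹' ⋃ i ∈ Finset.range n, f i) := by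
      intro a b hab
      refine Set.sdiff_subset_sdiff_right (Set.preimage_mono ?_)
      exact Set.biUnion_subset_biUnion_left (Finset.range_mono hab)
    have hlim := tendsto_measure_iInter_atTop (μ := m) (fun n =>
      ((measurable_prodMk_left (x := s) (MeasurableSet.iUnion hm)).diff
        (measurable_prodMk_left (x := s) (hfin n))).nullMeasurableSet) hanti
        ⟨0, measure_ne_top m _⟩
    have hempty : ⋂ n, (Prod.mk s ⁻¹' ⋃ i, f i) \
        (Prod.mk s ⁻¹' ⋃ i ∈ Finset.range n, f i) = ∅ := by
      refine Set.eq_empty_of_forall_notMem fun a ha => ?_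
      rw [Set.mem_iInter] at ha
      obtain ⟨i, hi⟩ := Set.mem_iUnion.1 (Set.mem_preimage.1 (ha 0).1)
      exact (ha (i + 1)).2 (Set.mem_iUnion₂.2 ⟨i, Finset.mem_range.2 (Nat.lt_succ_self i), hi⟩)
    rw [hempty, measure_empty] at hlim
    exact hlim

theorem stronglyMeasurable_toLp_simpleFunc [IsFiniteMeasure m] (hp : p ≠ ∞)
    (g : SimpleFunc (S × A) ℝ) :
    StronglyMeasurable fun s : S => MemLp.toLp _
      ((g.comp (Prod.mk s) measurable_prodMk_left).memLp_of_isFiniteMeasure p m) := by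
  induction g using SimpleFunc.induction with
  | const c hs =>
    convert! stronglyMeasurable_indicatorConstLp_section (m := m) hp c hs using 2 with s
  | add hd hf hg => exact hf.add hg

/-- The `L^p`-valued map `s ↦ f(s, ·)` is strongly measurable if `f` is jointly measurable. -/
theorem stronglyMeasurable_toLp [IsFiniteMeasure m] (hp : p ≠ ∞) {f : S → A → ℝ}
    (hf : Measurable (Function.uncurry f)) (h : ∀ s, MemLp (f s) p m) :
    StronglyMeasurable fun s => (h s).toLp (f s) := by
  refine stronglyMeasurable_of_tendsto Filter.atTop
    (fun n => stronglyMeasurable_toLp_simpleFunc (m := m) hp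
      (SimpleFunc.approxOn (Function.uncurry f) hf Set.univ 0 (Set.mem_univ _) n))
    (tendsto_pi_nhds.2 fun s => ?_)
  rw [Lp.tendsto_Lp_iff_tendsto_eLpNorm'']
  have := SimpleFunc.tendsto_approxOn_Lp_eLpNorm (μ := m) (p := p)
    (hf.comp (measurable_prodMk_left (x := s))) (Set.mem_univ (0 : ℝ)) hp (by simp)
    (by simpa using (h s).2)
  simp only [SimpleFunc.approxOn_comp hf measurable_prodMk_left] at this
  exact this

/-- A strongly measurable `L^p`-valued map has a jointly measurable version. -/
theorem exists_measurable_version_of_stronglyMeasurable [IsFiniteMeasure m] {Ψ : S → Lp ℝ p m}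
    (hΨ : StronglyMeasurable Ψ) :
    ∃ v : S → A → ℝ, Measurable (Function.uncurry v) ∧ ∀ s, v s =ᵐ[m] Ψ s := by
  rcases isEmpty_or_nonempty S with hS | hS
  · exact ⟨fun s => isEmptyElim s, measurable_of_empty _, fun s => isEmptyElim s⟩
  have hp0 : p ≠ 0 := (zero_lt_one.trans_le Fact.out).ne'
  have hsep := hΨ.isSeparable_range.separableSpace
  obtain ⟨e, he⟩ := TopologicalSpace.exists_dense_seq (Set.range Ψ)
  set δ : ℕ → ℝ≥0∞ := fun n => (2⁻¹ : ℝ≥0∞) ^ n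
  have hδ : ∀ n, 0 < δ n := fun n => ENNReal.pow_pos (by simp) n
  have hex : ∀ (n : ℕ) (s : S), ∃ k, edist (Ψ s) (e k : Lp ℝ p m) < δ n := by
    intro n s
    obtain ⟨k, hk⟩ := he.exists_mem_open (Metric.isOpen_eball (x := (⟨Ψ s, s, rfl⟩ : Set.range Ψ))
      (ε := δ n)) ⟨_, Metric.mem_eball_self (hδ n)⟩
    exact ⟨k, by rw [edist_comm]; exact hk⟩
  classical
  let k : ℕ → S → ℕ := fun n s => Nat.find (hex n s)
  have hk : ∀ n, Measurable (k n) := fun n =>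
    measurable_find (hex n) fun j =>
      (hΨ.edist (stronglyMeasurable_const (b := (e j : Lp ℝ p m)))).measurable measurableSet_Iio
  let vn : ℕ → S × A → ℝ := fun n q => (e (k n q.1) : Lp ℝ p m) q.2
  have hvn : ∀ n, Measurable (vn n) := by
    intro n
    have h1 : Measurable fun w : ℕ × A => (e w.1 : Lp ℝ p m) w.2 :=
      measurable_from_prod_countable_right fun j =>
        (Lp.stronglyMeasurable (e j : Lp ℝ p m)).measurable
    exact h1.comp (((hk n).comp measurable_fst).prodMk measurable_snd)
  refine ⟨fun s a => Filter.atTop.limUnder fun n => vn n (s, a),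
    (StronglyMeasurable.limUnder (l := Filter.atTop) (f := vn) fun n => (hvn n).stronglyMeasurable).measurable, fun s => ?_⟩
  have hclose : ∀ n, eLpNorm ((fun a => vn n (s, a)) - (Ψ s : A → ℝ)) p m < δ n := by
    intro n
    have := Nat.find_spec (hex n s)
    rw [edist_comm, Lp.edist_def] at this
    exact this
  have hmeas : ∀ n, AEStronglyMeasurable (fun a => vn n (s, a)) m := fun n =>
    ((hvn n).comp measurable_prodMk_left).aestronglyMeasurable
  have hcau : ∀ N n l : ℕ, N ≤ n → N ≤ l →
      eLpNorm ((fun a => vn n (s, a)) - fun a => vn l (s, a)) p m < 2 * δ N := by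
    intro N n l hn hl
    have hmono : ∀ j, N ≤ j → δ j ≤ δ N := fun j hj =>
      pow_le_pow_right_of_le_one' (by simp) hj
    have hsplit : (fun a => vn n (s, a)) - (fun a => vn l (s, a)) =
        ((fun a => vn n (s, a)) - (Ψ s : A → ℝ)) - ((fun a => vn l (s, a)) - (Ψ s : A → ℝ)) := by abel
    rw [hsplit, two_mul]
    refine (eLpNorm_sub_le ((hmeas n).sub (Lp.aestronglyMeasurable _))
      ((hmeas l).sub (Lp.aestronglyMeasurable _)) Fact.out).trans_lt ?_
    exact ENNReal.add_lt_add ((hclose n).trans_le (hmono n hn)) ((hclose l).trans_le (hmono l hl))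
  have hsum : ∑' n, 2 * δ n ≠ ∞ := by
    rw [ENNReal.tsum_mul_left, ENNReal.tsum_geometric]
    exact ENNReal.mul_ne_top (by simp) (by simp)
  have hae := Lp.ae_tendsto_of_cauchy_eLpNorm hmeas Fact.out hsum hcau
  have hae' : ∀ᵐ a ∂m, Filter.Tendsto (fun n => vn n (s, a)) Filter.atTop
      (nhds (Filter.atTop.limUnder fun n => vn n (s, a))) := by
    filter_upwards [hae] with a ha using tendsto_nhds_limUnder ha
  refine tendstoInMeasure_ae_unique (tendstoInMeasure_of_tendsto_ae hmeas hae')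
    (tendstoInMeasure_of_tendsto_eLpNorm hp0 hmeas (Lp.aestronglyMeasurable _) ?_)
  refine tendsto_of_tendsto_of_tendsto_of_le_of_le tendsto_const_nhds
    (ENNReal.tendsto_pow_atTop_nhds_zero_of_lt_one (by simp)) (fun n => zero_le)
    (fun n => (hclose n).le)

end LpValued

theorem one_le_of_one_le_cast {p : ℕ} (h : 1 ≤ (p : ℝ≥0∞)) : 1 ≤ p := by exact_mod_cast h

theorem eLpNorm_natCast_pow {A F : Type*} [MeasurableSpace A] [NormedAddCommGroup F]
    {m : Measure A} {p : ℕ} (hp : 1 ≤ p) (f : A → F) :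
    eLpNorm f (p : ℝ≥0∞) m ^ p = ∫⁻ a, ‖f a‖ₑ ^ p ∂m := by
  have h := eLpNorm_nnreal_pow_eq_lintegral (μ := m) (f := f) (p := (p : NNReal))
    (by exact_mod_cast (by omega : p ≠ 0))
  simpa only [NNReal.coe_natCast, ENNReal.rpow_natCast, ENNReal.coe_natCast] using h

theorem memLp_natCast_iff {A : Type*} [MeasurableSpace A] {m : Measure A} {p : ℕ} (hp : 1 ≤ p)
    {f : A → ℝ} (hf : Measurable f) :
    MemLp f (p : ℝ≥0∞) m ↔ ∫⁻ a, ‖f a‖ₑ ^ p ∂m < ∞ := by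
  rw [← eLpNorm_natCast_pow hp, ENNReal.pow_lt_top_iff]
  exact ⟨fun h => Or.inl h.2, fun h => ⟨hf.aestronglyMeasurable, h.resolve_right (by omega)⟩⟩

theorem Lp_enorm_sub_pow {A : Type*} [MeasurableSpace A] {m : Measure A} {p : ℕ} (hp : 1 ≤ p)
    (φ ψ : Lp ℝ (p : ℝ≥0∞) m) : ‖φ - ψ‖ₑ ^ p = ∫⁻ a, ‖φ a - ψ a‖ₑ ^ p ∂m := by
  rw [Lp.enorm_def, eLpNorm_natCast_pow hp]
  refine lintegral_congr_ae ?_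
  filter_upwards [Lp.coeFn_sub φ ψ] with a ha
  rw [ha, Pi.sub_apply]

theorem pathClass_congr {T Ω Ω' : Type*} [MeasurableSpace T] {μ : Measure T} {p : ℕ}
    {X : T → Ω → ℝ} {Y : T → Ω' → ℝ} {ω : Ω} {ω' : Ω'}
    (h : (fun t => X t ω) =ᵐ[μ] fun t => Y t ω') : pathClass p μ X ω = pathClass p μ Y ω' := by
  unfold pathClass
  by_cases hX : MemLp (fun t => X t ω) (p : ℝ≥0∞) μ
  · rw [dif_pos hX, dif_pos ((memLp_congr_ae h).1 hX)]
    exact (MemLp.toLp_eq_toLp_iff _ _).2 h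
  · rw [dif_neg hX, dif_neg fun h' => hX ((memLp_congr_ae h).2 h')]

theorem pathClass_ae_eq {T Ω : Type*} [MeasurableSpace T] {μ : Measure T} {p : ℕ} {X : T → Ω → ℝ} {ω : Ω}
    (h : MemLp (fun t => X t ω) (p : ℝ≥0∞) μ) :
    pathClass p μ X ω =ᵐ[μ] fun t => X t ω := by
  rw [pathClass, dif_pos h]
  exact h.coeFn_toLp

section PathClass

variable {T Ω Ω' : Type*} [MeasurableSpace T] [MeasurableSpace Ω] [MeasurableSpace Ω']
  {μ : Measure T} {P : Measure Ω} {P' : Measure Ω'} {p : ℕ}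

theorem MeasurableProcess.measurable_eval {X : T → Ω → ℝ} (hX : MeasurableProcess X) (t : T) :
    Measurable (X t) :=
  hX.comp measurable_prodMk_left

theorem MeasurableProcess.measurable_path {X : T → Ω → ℝ} (hX : MeasurableProcess X) (ω : Ω) :
    Measurable fun t => X t ω :=
  hX.comp measurable_prodMk_right

theorem MeasurableProcess.measurable_flip {X : T → Ω → ℝ} (hX : MeasurableProcess X) :
    Measurable fun q : Ω × T => X q.2 q.1 :=
  hX.comp measurable_swap

theorem IsRepresentative.ae_eq [SFinite μ] [SFinite P] {X X' : T → Ω → ℝ}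
    (hX : MeasurableProcess X) (h : IsRepresentative μ P X X') :
    ∀ᵐ t ∂μ, X' t =ᵐ[P] X t := by
  have hm : MeasurableSet {q : T × Ω | X' q.1 q.2 = X q.1 q.2} := measurableSet_eq_fun h.1 hX
  exact (Measure.ae_ae_comm hm).2 h.2

variable [Fact (1 ≤ (p : ℝ≥0∞))]

theorem measurable_pathClass [IsFiniteMeasure μ] {X : T → Ω → ℝ} (hX : MeasurableProcess X) :
    Measurable (pathClass p μ X) := by
  have hp : 1 ≤ p := one_le_of_one_le_cast Fact.out
  set G : Set Ω := {ω | ∫⁻ t, ‖X t ω‖ₑ ^ p ∂μ < ∞} with hG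
  have hGm : MeasurableSet G :=
    (hX.measurable_flip.enorm.pow_const p).lintegral_prod_right' measurableSet_Iio
  classical
  let X₀ : Ω → T → ℝ := fun ω t => if ω ∈ G then X t ω else 0
  have hX₀ : Measurable (Function.uncurry X₀) :=
    Measurable.ite (measurable_fst hGm) hX.measurable_flip measurable_const
  have hmem : ∀ ω, MemLp (X₀ ω) (p : ℝ≥0∞) μ := by
    intro ω
    by_cases hω : ω ∈ G
    · have : X₀ ω = fun t => X t ω := funext fun t => if_pos hω
      rw [this]
      exact (memLp_natCast_iff hp (hX.measurable_path ω)).2 hω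
    · have : X₀ ω = 0 := funext fun t => if_neg hω
      rw [this]
      exact MemLp.zero
  have h := (stronglyMeasurable_toLp (m := μ) (ENNReal.natCast_ne_top p) hX₀ hmem).measurable
  convert! h using 1
  ext1 ω
  by_cases hω : ω ∈ G
  · have : X₀ ω = fun t => X t ω := funext fun t => if_pos hω
    rw [pathClass, dif_pos ((memLp_natCast_iff hp (hX.measurable_path ω)).2 hω)]
    simp only [this]
  · have : X₀ ω = 0 := funext fun t => if_neg hω
    rw [pathClass, dif_neg fun h => hω ((memLp_natCast_iff hp (hX.measurable_path ω)).1 h)]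
    simp only [this]
    exact (MemLp.toLp_zero _).symm

theorem ae_memLp_path [SFinite μ] [SFinite P] {X : T → Ω → ℝ} (hX : MeasurableProcess X)
    (h : ∫⁻ t, ∫⁻ ω, ‖X t ω‖ₑ ^ p ∂P ∂μ < ∞) :
    ∀ᵐ ω ∂P, MemLp (fun t => X t ω) (p : ℝ≥0∞) μ := by
  have hp : 1 ≤ p := one_le_of_one_le_cast Fact.out
  rw [lintegral_lintegral_swap (hX.enorm.pow_const p).aemeasurable] at h
  have h' := ae_lt_top ((hX.measurable_flip.enorm.pow_const p).lintegral_prod_right') h.ne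
  filter_upwards [h'] with ω hω
  exact (memLp_natCast_iff hp (hX.measurable_path ω)).2 hω

/-- The `L^p`-cost of a pair of measurable processes is the integral of the costs in time. -/
theorem lintegral_enorm_pathClass_sub [SFinite μ] [SFinite P] {X Y : T → Ω → ℝ}
    (hX : MeasurableProcess X) (hY : MeasurableProcess Y)
    (hXp : ∀ᵐ ω ∂P, MemLp (fun t => X t ω) (p : ℝ≥0∞) μ)
    (hYp : ∀ᵐ ω ∂P, MemLp (fun t => Y t ω) (p : ℝ≥0∞) μ) :
    ∫⁻ ω, ‖pathClass p μ X ω - pathClass p μ Y ω‖ₑ ^ p ∂P =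
      ∫⁻ t, ∫⁻ ω, ‖X t ω - Y t ω‖ₑ ^ p ∂P ∂μ := by
  have hp : 1 ≤ p := one_le_of_one_le_cast Fact.out
  have hXY : Measurable fun q : T × Ω => X q.1 q.2 - Y q.1 q.2 := Measurable.sub hX hY
  rw [lintegral_lintegral_swap (hXY.enorm.pow_const p).aemeasurable]
  refine lintegral_congr_ae ?_
  filter_upwards [hXp, hYp] with ω h1 h2
  rw [Lp_enorm_sub_pow hp]
  refine lintegral_congr_ae ?_
  filter_upwards [pathClass_ae_eq h1, pathClass_ae_eq h2] with t h3 h4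
  rw [h3, h4]

/-- A jointly measurable evaluation map on `L^p`. -/
theorem exists_measurable_evaluation [MeasurableSpace.CountablyGenerated T] (μ : Measure T)
    [IsFiniteMeasure μ] :
    ∃ ev : Lp ℝ (p : ℝ≥0∞) μ → T → ℝ, Measurable (Function.uncurry ev) ∧
      ∀ φ, ev φ =ᵐ[μ] φ := by
  have : Fact ((p : ℝ≥0∞) ≠ ∞) := ⟨ENNReal.natCast_ne_top p⟩
  exact exists_measurable_version_of_stronglyMeasurable
    (Ψ := fun φ : Lp ℝ (p : ℝ≥0∞) μ => φ) measurable_id.stronglyMeasurable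

end PathClass

section Transfer

theorem enorm_toLp_sub_pow {p : ℕ} [Fact (1 ≤ (p : ℝ≥0∞))] {A : Type*}
    [MeasurableSpace A] {m : Measure A} {f g : A → ℝ}
    (hf : MemLp f (p : ℝ≥0∞) m) (hg : MemLp g (p : ℝ≥0∞) m) :
    ‖hf.toLp f - hg.toLp g‖ₑ ^ p = ∫⁻ a, ‖f a - g a‖ₑ ^ p ∂m := by
  rw [Lp_enorm_sub_pow (one_le_of_one_le_cast Fact.out)]
  refine lintegral_congr_ae ?_
  filter_upwards [hf.coeFn_toLp, hg.coeFn_toLp] with a h1 h2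
  rw [h1, h2]

theorem enorm_toLp_pow {p : ℕ} [Fact (1 ≤ (p : ℝ≥0∞))] {A : Type*}
    [MeasurableSpace A] {m : Measure A} {f : A → ℝ}
    (hf : MemLp f (p : ℝ≥0∞) m) : ‖hf.toLp f‖ₑ ^ p = ∫⁻ a, ‖f a‖ₑ ^ p ∂m := by
  rw [Lp.enorm_def, eLpNorm_natCast_pow (one_le_of_one_le_cast Fact.out)]
  refine lintegral_congr_ae ?_
  filter_upwards [hf.coeFn_toLp] with a ha
  rw [ha]

variable {T Ω Ω' : Type*} [MeasurableSpace Ω] [MeasurableSpace Ω']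
  {P : Measure Ω} {P' : Measure Ω'} {p : ℕ}

theorem lintegral_pathLaw {X : T → Ω → ℝ} (hX : ∀ t, Measurable (X t)) {g : (T → ℝ) → ℝ≥0∞}
    (hg : Measurable g) : ∫⁻ x, g x ∂pathLaw P X = ∫⁻ ω, g (fun t => X t ω) ∂P :=
  lintegral_map hg (measurable_pi_lambda _ hX)

theorem lintegral_enorm_sub_pow_congr {X : T → Ω → ℝ} {Z : T → Ω' → ℝ}
    (hX : ∀ t, Measurable (X t)) (hZ : ∀ t, Measurable (Z t)) (h : pathLaw P X = pathLaw P' Z)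
    (s t : T) : ∫⁻ ω, ‖X s ω - X t ω‖ₑ ^ p ∂P = ∫⁻ ω, ‖Z s ω - Z t ω‖ₑ ^ p ∂P' := by
  have hg : Measurable fun x : T → ℝ => ‖x s - x t‖ₑ ^ p := by fun_prop
  rw [← lintegral_pathLaw hX hg, h, lintegral_pathLaw hZ hg]

theorem lintegral_enorm_pow_congr {X : T → Ω → ℝ} {Z : T → Ω' → ℝ}
    (hX : ∀ t, Measurable (X t)) (hZ : ∀ t, Measurable (Z t)) (h : pathLaw P X = pathLaw P' Z)
    (t : T) : ∫⁻ ω, ‖X t ω‖ₑ ^ p ∂P = ∫⁻ ω, ‖Z t ω‖ₑ ^ p ∂P' := by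
  have hg : Measurable fun x : T → ℝ => ‖x t‖ₑ ^ p := by fun_prop
  rw [← lintegral_pathLaw hX hg, h, lintegral_pathLaw hZ hg]

variable [MeasurableSpace T]

theorem measurableProcess_comp_simpleFunc {Z : T → Ω → ℝ} (hZ : ∀ t, Measurable (Z t))
    (τ : SimpleFunc T T) : MeasurableProcess fun t ω => Z (τ t) ω :=
  SimpleFunc.measurable_bind (τ.comp Prod.fst measurable_fst)
    (fun t (q : T × Ω) => Z t q.2) fun t => (hZ t).comp measurable_snd

variable [Fact (1 ≤ (p : ℝ≥0∞))]

/-- A process with the same law on `ℝ^T` as a measurable process has a measurable modification. -/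
theorem exists_measurable_modification [IsProbabilityMeasure P] [IsProbabilityMeasure P']
    {X : T → Ω → ℝ} {Z : T → Ω' → ℝ} (hX : MeasurableProcess X) (hZ : ∀ t, Measurable (Z t))
    (hXp : ∀ t, ∫⁻ ω, ‖X t ω‖ₑ ^ p ∂P < ∞) (h : pathLaw P X = pathLaw P' Z) :
    ∃ V : T → Ω' → ℝ, MeasurableProcess V ∧ ∀ t, V t =ᵐ[P'] Z t := by
  have hp : 1 ≤ p := one_le_of_one_le_cast Fact.out
  have hXm : ∀ t, MemLp (X t) (p : ℝ≥0∞) P := fun t =>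
    (memLp_natCast_iff hp (hX.measurable_eval t)).2 (hXp t)
  have hZm : ∀ t, MemLp (Z t) (p : ℝ≥0∞) P' := fun t =>
    (memLp_natCast_iff hp (hZ t)).2
      (lintegral_enorm_pow_congr hX.measurable_eval hZ h t ▸ hXp t)
  let Φ : T → Lp ℝ (p : ℝ≥0∞) P := fun t => (hXm t).toLp (X t)
  let Ψ : T → Lp ℝ (p : ℝ≥0∞) P' := fun t => (hZm t).toLp (Z t)
  have hΦ : StronglyMeasurable Φ := stronglyMeasurable_toLp (ENNReal.natCast_ne_top p) hX hXm
  have hdist : ∀ s t, edist (Ψ s) (Ψ t) = edist (Φ s) (Φ t) := by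
    intro s t
    rw [edist_eq_enorm_sub, edist_eq_enorm_sub]
    refine (ENNReal.pow_right_strictMono (by omega : p ≠ 0)).injective ?_
    change ‖Ψ s - Ψ t‖ₑ ^ p = ‖Φ s - Φ t‖ₑ ^ p
    rw [enorm_toLp_sub_pow, enorm_toLp_sub_pow,
      lintegral_enorm_sub_pow_congr hX.measurable_eval hZ h]
  let j : Set.range Φ → Lp ℝ (p : ℝ≥0∞) P' := fun φ => Ψ φ.2.choose
  have hj : Isometry j := fun φ ψ => by
    rw [hdist, φ.2.choose_spec, ψ.2.choose_spec]; rfl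
  have hsep := hΦ.isSeparable_range.separableSpace
  have hsc : SecondCountableTopology (Set.range Φ) := UniformSpace.secondCountable_of_separable _
  have hfac : StronglyMeasurable fun t => (⟨Φ t, t, rfl⟩ : Set.range Φ) :=
    (hΦ.measurable.subtype_mk).stronglyMeasurable
  have hΨ : StronglyMeasurable Ψ := by
    convert! hj.continuous.comp_stronglyMeasurable hfac using 1
    ext1 t
    have hmem : ∃ y, Φ y = Φ t := ⟨t, rfl⟩
    refine edist_eq_zero.1 ((hdist t hmem.choose).trans ?_)
    rw [hmem.choose_spec, edist_self]
  obtain ⟨V, hV, hVΨ⟩ := exists_measurable_version_of_stronglyMeasurable hΨ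
  exact ⟨V, hV, fun t => (hVΨ t).trans (hZm t).coeFn_toLp⟩

/-- A measurable process is approximated in `L^p` by its values at finitely many times. -/
theorem exists_simpleFunc_time_approx [Nonempty T] {μ : Measure T} [IsFiniteMeasure μ]
    [IsProbabilityMeasure P] {X : T → Ω → ℝ} (hX : MeasurableProcess X)
    (hXt : ∀ t, ∫⁻ ω, ‖X t ω‖ₑ ^ p ∂P < ∞)
    (hXp : ∫⁻ t, ∫⁻ ω, ‖X t ω‖ₑ ^ p ∂P ∂μ < ∞) :
    ∃ τ : ℕ → SimpleFunc T T, Filter.Tendsto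
      (fun n => ∫⁻ t, ∫⁻ ω, ‖X (τ n t) ω - X t ω‖ₑ ^ p ∂P ∂μ) Filter.atTop (nhds 0) := by
  obtain ⟨t₀⟩ := ‹Nonempty T›
  have hp : 1 ≤ p := one_le_of_one_le_cast Fact.out
  have hXm : ∀ t, MemLp (X t) (p : ℝ≥0∞) P := fun t =>
    (memLp_natCast_iff hp (hX.measurable_eval t)).2 (hXt t)
  let Φ : T → Lp ℝ (p : ℝ≥0∞) P := fun t => (hXm t).toLp (X t)
  have hΦ : StronglyMeasurable Φ := stronglyMeasurable_toLp (ENNReal.natCast_ne_top p) hX hXm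
  have hsep := hΦ.isSeparable_range.separableSpace
  have ht₀ : Φ t₀ ∈ Set.range Φ := ⟨t₀, rfl⟩
  let s : ℕ → SimpleFunc T (Lp ℝ (p : ℝ≥0∞) P) :=
    SimpleFunc.approxOn Φ hΦ.measurable (Set.range Φ) (Φ t₀) ht₀
  classical
  let g : Lp ℝ (p : ℝ≥0∞) P → T := fun φ => if hφ : ∃ t, Φ t = φ then hφ.choose else t₀
  let τ : ℕ → SimpleFunc T T := fun n => (s n).map g
  have hτ : ∀ n t, Φ (τ n t) = s n t := by
    intro n t
    have hmem : s n t ∈ Set.range Φ := SimpleFunc.approxOn_mem hΦ.measurable ht₀ n t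
    have hex : ∃ t', Φ t' = s n t := hmem
    have : τ n t = hex.choose := by
      change g (s n t) = _
      exact dif_pos hex
    rw [this, hex.choose_spec]
  have hΦint : eLpNorm (fun t => Φ t - Φ t₀) (p : ℝ≥0∞) μ < ∞ := by
    have h1 : MemLp Φ (p : ℝ≥0∞) μ := by
      refine ⟨hΦ.aestronglyMeasurable, ?_⟩
      have h2 : eLpNorm Φ (p : ℝ≥0∞) μ ^ p < ∞ := by
        rw [eLpNorm_natCast_pow hp]
        exact lt_of_eq_of_lt (lintegral_congr fun t => enorm_toLp_pow (hXm t)) hXp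
      exact (ENNReal.pow_lt_top_iff.1 h2).resolve_right (by omega)
    exact (h1.sub (memLp_const _)).2
  have hlim := SimpleFunc.tendsto_approxOn_Lp_eLpNorm (μ := μ) hΦ.measurable
    ht₀ (ENNReal.natCast_ne_top p)
    (ae_of_all _ fun t => subset_closure (Set.mem_range_self t)) hΦint
  have hcost : ∀ n, eLpNorm (⇑(s n) - Φ) (p : ℝ≥0∞) μ ^ p =
      ∫⁻ t, ∫⁻ ω, ‖X (τ n t) ω - X t ω‖ₑ ^ p ∂P ∂μ := by
    intro n
    rw [eLpNorm_natCast_pow hp]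
    refine lintegral_congr fun t => ?_
    rw [Pi.sub_apply, ← hτ n t]
    exact enorm_toLp_sub_pow _ _
  refine ⟨τ, Filter.Tendsto.congr hcost ?_⟩
  have := ((ENNReal.continuous_pow p).tendsto 0).comp hlim
  rwa [zero_pow (by omega)] at this

theorem tendstoInDistribution_pathClass_comp_simpleFunc [MeasurableSpace.CountablyGenerated T]
    {μ : Measure T} [IsFiniteMeasure μ] [IsProbabilityMeasure P] {X : T → Ω → ℝ}
    (hX : MeasurableProcess X) (hXp : ∫⁻ t, ∫⁻ ω, ‖X t ω‖ₑ ^ p ∂P ∂μ < ∞)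
    {τ : ℕ → SimpleFunc T T} (hτ : Filter.Tendsto
      (fun n => ∫⁻ t, ∫⁻ ω, ‖X (τ n t) ω - X t ω‖ₑ ^ p ∂P ∂μ) Filter.atTop (nhds 0)) :
    TendstoInDistribution (fun n => pathClass p μ fun t ω => X (τ n t) ω) Filter.atTop
      (pathClass p μ X) (fun _ => P) P := by
  have hp : 1 ≤ p := one_le_of_one_le_cast Fact.out
  have : Fact ((p : ℝ≥0∞) ≠ ∞) := ⟨ENNReal.natCast_ne_top p⟩
  have hm : ∀ n, Measurable (pathClass p μ fun t ω => X (τ n t) ω) := fun n =>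
    measurable_pathClass (measurableProcess_comp_simpleFunc hX.measurable_eval (τ n))
  have hcost : ∀ n, (∫⁻ t, ∫⁻ ω, ‖X (τ n t) ω - X t ω‖ₑ ^ p ∂P ∂μ) ^ (1 / (p : ℝ)) =
      eLpNorm ((pathClass p μ fun t ω => X (τ n t) ω) - pathClass p μ X) (p : ℝ≥0∞) P := by
    intro n
    rw [← lintegral_enorm_pathClass_sub
      (measurableProcess_comp_simpleFunc hX.measurable_eval (τ n)) hX
      (ae_of_all _ fun ω => ((τ n).map fun t => X t ω).memLp_of_isFiniteMeasure _ _)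
      (ae_memLp_path hX hXp)]
    have h1 := eLpNorm_natCast_pow (m := P) hp
      ((pathClass p μ fun t ω => X (τ n t) ω) - pathClass p μ X)
    simp only [Pi.sub_apply] at h1
    rw [← h1, ← ENNReal.rpow_natCast, ← ENNReal.rpow_mul,
      mul_one_div_cancel (by exact_mod_cast (by omega : p ≠ 0)), ENNReal.rpow_one]
  have hlim : Filter.Tendsto (fun n => eLpNorm ((pathClass p μ fun t ω => X (τ n t) ω) -
      pathClass p μ X) (p : ℝ≥0∞) P) Filter.atTop (nhds 0) := by
    refine Filter.Tendsto.congr hcost ?_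
    have h1 : (0 : ℝ) < 1 / (p : ℝ) := by positivity
    have := ((ENNReal.continuous_rpow_const (y := 1 / (p : ℝ))).tendsto 0).comp hτ
    rwa [ENNReal.zero_rpow_of_pos h1] at this
  exact (tendstoInMeasure_of_tendsto_eLpNorm (by exact_mod_cast (by omega : p ≠ 0))
    (fun n => (hm n).aestronglyMeasurable) (measurable_pathClass hX).aestronglyMeasurable
    hlim).tendstoInDistribution fun n => (hm n).aemeasurable

/-- Measurable processes with the same law on `ℝ^T` have the same law on `L^p(T)`. -/
theorem map_pathClass_eq_of_pathLaw_eq [MeasurableSpace.CountablyGenerated T] {μ : Measure T}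
    [IsFiniteMeasure μ] [IsProbabilityMeasure P] [IsProbabilityMeasure P']
    {X : T → Ω → ℝ} {V : T → Ω' → ℝ} (hX : MeasurableProcess X) (hV : MeasurableProcess V)
    (hXt : ∀ t, ∫⁻ ω, ‖X t ω‖ₑ ^ p ∂P < ∞)
    (hXp : ∫⁻ t, ∫⁻ ω, ‖X t ω‖ₑ ^ p ∂P ∂μ < ∞) (h : pathLaw P X = pathLaw P' V) :
    P.map (pathClass p μ X) = P'.map (pathClass p μ V) := by
  rcases isEmpty_or_nonempty T with hT | hT
  · have hsub : Subsingleton (Lp ℝ (p : ℝ≥0∞) μ) :=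
      ⟨fun f g => Lp.ext (ae_of_all _ fun t => isEmptyElim t)⟩
    have := Measure.isProbabilityMeasure_map (μ := P)
      (measurable_pathClass (p := p) (μ := μ) hX).aemeasurable
    have := Measure.isProbabilityMeasure_map (μ := P')
      (measurable_pathClass (p := p) (μ := μ) hV).aemeasurable
    ext s _
    rcases s.eq_empty_or_nonempty with rfl | hs
    · simp
    · rw [Subsingleton.eq_univ_of_nonempty hs, measure_univ, measure_univ]
  obtain ⟨τ, hτ⟩ := exists_simpleFunc_time_approx hX hXt hXp
  have hVp : ∫⁻ t, ∫⁻ ω, ‖V t ω‖ₑ ^ p ∂P' ∂μ < ∞ := by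
    simpa only [lintegral_enorm_pow_congr hX.measurable_eval hV.measurable_eval h] using hXp
  have hd1 := tendstoInDistribution_pathClass_comp_simpleFunc hX hXp hτ
  simp only [lintegral_enorm_sub_pow_congr hX.measurable_eval hV.measurable_eval h] at hτ
  have hd2 := tendstoInDistribution_pathClass_comp_simpleFunc hV hVp hτ
  have hlaw : ∀ n, P.map (pathClass p μ fun t ω => X (τ n t) ω) =
      P'.map (pathClass p μ fun t ω => V (τ n t) ω) := by
    intro n
    have hcanon : MeasurableProcess fun (t : T) (x : T → ℝ) => x (τ n t) :=
      measurableProcess_comp_simpleFunc (Z := fun t (x : T → ℝ) => x t)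
        (fun t => measurable_pi_apply t) (τ n)
    have h1 := Measure.map_map (μ := P) (measurable_pathClass (p := p) (μ := μ) hcanon)
      (measurable_pi_lambda _ hX.measurable_eval)
    have h2 := Measure.map_map (μ := P') (measurable_pathClass (p := p) (μ := μ) hcanon)
      (measurable_pi_lambda _ hV.measurable_eval)
    change (pathLaw P X).map _ = _ at h1
    change (pathLaw P' V).map _ = _ at h2
    rw [h, h2] at h1
    exact h1.symm
  have : Fact ((p : ℝ≥0∞) ≠ ∞) := ⟨ENNReal.natCast_ne_top p⟩
  refine tendstoInDistribution_unique _ hd1 ⟨hd1.forall_aemeasurable, hd2.aemeasurable_limit, ?_⟩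
  convert! hd2.tendsto using 3
  exact congrArg Filter.Tendsto (funext fun n => Subtype.ext (hlaw n))

end Transfer

theorem quantileFn_dirac_zero {u : ℝ} (hu : u ∈ Set.Ioo (0 : ℝ) 1) :
    quantileFn (Measure.dirac 0) u = 0 := by
  have hcdf : ∀ x : ℝ, cdf (Measure.dirac (0 : ℝ)) x = (Set.Iic x).indicator 1 0 := fun x => by
    rw [cdf_eq_real, Measure.real, Measure.dirac_apply' _ measurableSet_Iic]
    by_cases h : (0 : ℝ) ∈ Set.Iic x <;> simp [h]
  apply le_antisymm
  · rw [quantileFn_le_iff _ hu, hcdf]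
    simpa using hu.2.le
  · by_contra! hlt
    have := (quantileFn_le_iff (Measure.dirac 0) hu _).1 le_rfl
    rw [hcdf, Set.indicator_of_notMem (by simpa using hlt)] at this
    exact absurd this (not_le.2 hu.1)

section Comonotone

variable {Ω : Type*} [MeasurableSpace Ω]

theorem map_zero_prodMk_eq_quantileCoupling (ρ : Measure Ω) [IsProbabilityMeasure ρ] :
    ρ.map (fun _ => ((0 : ℝ), (0 : ℝ))) =
      quantileCoupling (ρ.map fun _ => (0 : ℝ)) (ρ.map fun _ => (0 : ℝ)) := by
  have h : (fun u => (quantileFn (Measure.dirac 0) u, quantileFn (Measure.dirac 0) u)) =ᵐ[unif01]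
      fun _ => ((0 : ℝ), (0 : ℝ)) := by
    filter_upwards [ae_unif01_mem_Ioo] with u hu
    rw [quantileFn_dirac_zero hu]
  rw [Measure.map_const, Measure.map_const, measure_univ, one_smul, one_smul, quantileCoupling,
    Measure.map_congr h, Measure.map_const, measure_univ, one_smul]

/-- After an independent randomisation, the two components of a comonotone pair are quantile
transforms of the same uniform variable. -/
theorem exists_uniform_of_comonotone (ρ : Measure Ω) [IsProbabilityMeasure ρ] {A B : Ω → ℝ}
    (hA : Measurable A) (hB : Measurable B)
    (h : ρ.map (fun ω => (A ω, B ω)) = quantileCoupling (ρ.map A) (ρ.map B)) :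
    ∃ U : Ω × unitInterval → ℝ, Measurable U ∧ (ρ.prod volume).map U = unif01 ∧
      (∀ᵐ q ∂ρ.prod volume, A q.1 = quantileFn (ρ.map A) (U q)) ∧
      ∀ᵐ q ∂ρ.prod volume, B q.1 = quantileFn (ρ.map B) (U q) := by
  set q₁ := quantileFn (ρ.map A)
  set q₂ := quantileFn (ρ.map B)
  have hq₁ : Measurable q₁ := measurable_quantileFn _
  have hq₂ : Measurable q₂ := measurable_quantileFn _
  have hq : Measurable fun u => ((q₁ u, q₂ u), u) := (hq₁.prodMk hq₂).prodMk measurable_id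
  let θ : Measure ((ℝ × ℝ) × ℝ) := unif01.map fun u => ((q₁ u, q₂ u), u)
  have hθ : IsProbabilityMeasure θ := Measure.isProbabilityMeasure_map hq.aemeasurable
  have hθfst : θ.fst = ρ.map (fun ω => (A ω, B ω)) := by
    rw [h, Measure.fst, Measure.map_map measurable_fst hq]
    rfl
  obtain ⟨f, hf, hfθ⟩ := exists_measurable_randomization θ
  have hAB : Measurable fun ω => (A ω, B ω) := hA.prodMk hB
  let U : Ω × unitInterval → ℝ := fun q => f (A q.1, B q.1) q.2
  have hU : Measurable U := hf.comp ((hAB.comp measurable_fst).prodMk measurable_snd)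
  have hpair : Measurable fun q : Ω × unitInterval => ((A q.1, B q.1), U q) :=
    (hAB.comp measurable_fst).prodMk hU
  have hfm : Measurable fun q : (ℝ × ℝ) × unitInterval => (q.1, f q.1 q.2) :=
    measurable_fst.prodMk hf
  have hlaw : (ρ.prod volume).map (fun q => ((A q.1, B q.1), U q)) = θ := by
    have hprod : (ρ.prod (volume : Measure unitInterval)).map (Prod.map (fun ω => (A ω, B ω)) id) =
        θ.fst.prod volume := by
      rw [hθfst, ← Measure.map_prod_map ρ volume hAB measurable_id, Measure.map_id]
    rw [← hprod, Measure.map_map hfm (hAB.prodMap measurable_id)] at hfθ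
    exact hfθ
  have hθae : ∀ᵐ z ∂θ, z.1.1 = q₁ z.2 ∧ z.1.2 = q₂ z.2 := by
    rw [ae_map_iff hq.aemeasurable]
    · exact ae_of_all _ fun u => ⟨rfl, rfl⟩
    · exact (measurableSet_eq_fun (measurable_fst.comp measurable_fst)
        (hq₁.comp measurable_snd)).inter (measurableSet_eq_fun
        (measurable_snd.comp measurable_fst) (hq₂.comp measurable_snd))
  rw [← hlaw] at hθae
  have hae := ae_of_ae_map hpair.aemeasurable hθae
  refine ⟨U, hU, ?_, hae.mono fun q h => h.1, hae.mono fun q h => h.2⟩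
  have h1 : ((ρ.prod volume).map (fun q => ((A q.1, B q.1), U q))).map Prod.snd =
      θ.map Prod.snd := by rw [hlaw]
  rw [Measure.map_map measurable_snd hpair, Measure.map_map measurable_snd hq] at h1
  exact h1.trans Measure.map_id

/-- Two processes that are comonotone at each time share a path copula. -/
theorem exists_common_copula_of_comonotone {T : Type*} (ρ : Measure Ω) [IsProbabilityMeasure ρ]
    {A B : T → Ω → ℝ} (hA : ∀ t, Measurable (A t)) (hB : ∀ t, Measurable (B t))
    (h : ∀ t, ρ.map (fun ω => (A t ω, B t ω)) = quantileCoupling (ρ.map (A t)) (ρ.map (B t))) :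
    ∃ C : Measure (T → ℝ), IsCopulaMeasure C ∧ SklarRel C (pathLaw ρ A) ∧
      SklarRel C (pathLaw ρ B) := by
  choose U hU hunif hUA hUB using fun t => exists_uniform_of_comonotone ρ (hA t) (hB t) (h t)
  have hcop : IsCopulaProcess (ρ.prod volume) U := isCopulaProcess_of_map_eq hU hunif
  have hlift : ∀ {D : T → Ω → ℝ}, (∀ t, Measurable (D t)) →
      (∀ t, ∀ᵐ q ∂ρ.prod (volume : Measure unitInterval),
        D t q.1 = quantileFn (ρ.map (D t)) (U t q)) →
      SklarRel (pathLaw (ρ.prod volume) U) (pathLaw ρ D) := by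
    intro D hD hDU
    have hfst : (ρ.prod (volume : Measure unitInterval)).map Prod.fst = ρ := by
      rw [Measure.map_fst_prod, measure_univ, one_smul]
    have hpath : pathLaw ρ D = pathLaw (ρ.prod (volume : Measure unitInterval))
        fun t q => D t q.1 := by
      conv_lhs => rw [← hfst]
      exact Measure.map_map (measurable_pi_lambda _ hD) measurable_fst
    have hmarg : ∀ t, (ρ.prod (volume : Measure unitInterval)).map (fun q => D t q.1) =
        ρ.map (D t) := fun t => by
      conv_rhs => rw [← hfst]
      exact (Measure.map_map (hD t) measurable_fst).symm
    rw [hpath]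
    refine sklarRel_of_ae_eq_quantileFn hcop (fun t => (hD t).comp measurable_fst) fun t => ?_
    rw [hmarg t]
    exact hDU t
  exact ⟨pathLaw (ρ.prod volume) U, hcop.2, hlift hA hUA, hlift hB hUB⟩

end Comonotone

section OptimalCoupling

variable {E : Type*} [NormedAddCommGroup E] [MeasurableSpace E] [BorelSpace E]
  [SecondCountableTopology E]

theorem lowerSemicontinuous_lintegral_enorm_sub_pow (p : ℕ) :
    LowerSemicontinuous fun ρ : ProbabilityMeasure (E × E) =>
      ∫⁻ q, ‖q.1 - q.2‖ₑ ^ p ∂(ρ : Measure (E × E)) := by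
  let g : ℕ → BoundedContinuousFunction (E × E) NNReal := fun n =>
    BoundedContinuousFunction.mkOfBound
      ⟨fun q => min (n : NNReal) (‖q.1 - q.2‖₊ ^ p), by fun_prop⟩ n (by
        intro x y
        rw [NNReal.dist_eq]
        exact abs_sub_le_of_nonneg_of_le (NNReal.coe_nonneg _)
          (NNReal.coe_le_coe.2 (min_le_left _ _)) (NNReal.coe_nonneg _)
          (NNReal.coe_le_coe.2 (min_le_left _ _)))
  have hg : ∀ ρ : ProbabilityMeasure (E × E), ∫⁻ q, ‖q.1 - q.2‖ₑ ^ p ∂(ρ : Measure (E × E)) =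
      ⨆ n, ∫⁻ q, g n q ∂(ρ : Measure (E × E)) := by
    intro ρ
    rw [← lintegral_iSup]
    · refine lintegral_congr fun q => ?_
      apply le_antisymm
      · obtain ⟨n, hn⟩ := exists_nat_ge (‖q.1 - q.2‖₊ ^ p)
        refine le_iSup_of_le n ?_
        change ((‖q.1 - q.2‖₊ : ℝ≥0∞)) ^ p ≤ ((min (n : NNReal) (‖q.1 - q.2‖₊ ^ p) : NNReal) : ℝ≥0∞)
        rw [min_eq_right hn, ENNReal.coe_pow]
      · refine iSup_le fun n => ?_
        change ((min (n : NNReal) (‖q.1 - q.2‖₊ ^ p) : NNReal) : ℝ≥0∞) ≤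
          ((‖q.1 - q.2‖₊ : ℝ≥0∞)) ^ p
        rw [← ENNReal.coe_pow]
        exact ENNReal.coe_le_coe.2 (min_le_right _ _)
    · intro n
      exact (g n).continuous.measurable.coe_nnreal_ennreal
    · intro a b hab q
      exact ENNReal.coe_le_coe.2 (min_le_min (Nat.cast_le.2 hab) le_rfl)
  simp_rw [hg]
  refine lowerSemicontinuous_iSup fun n => Continuous.lowerSemicontinuous ?_
  rw [continuous_iff_continuousAt]
  intro ρ
  exact ProbabilityMeasure.tendsto_iff_forall_lintegral_tendsto.1 Filter.tendsto_id (g n)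

/-- Optimal couplings exist. -/
theorem exists_coupling_le_wasserstein [CompleteSpace E] {p : ℕ} (hp : 1 ≤ p)
    (ν₁ ν₂ : Measure E) [IsProbabilityMeasure ν₁] [IsProbabilityMeasure ν₂] :
    ∃ ρ, IsCoupling ν₁ ν₂ ρ ∧ ∫⁻ q, ‖q.1 - q.2‖ₑ ^ p ∂ρ ≤ wasserstein p ν₁ ν₂ ^ p := by
  let K : Set (ProbabilityMeasure (E × E)) := {ρ | IsCoupling ν₁ ν₂ (ρ : Measure (E × E))}
  have hclosed : IsClosed K := by
    have h1 : Continuous fun ρ : ProbabilityMeasure (E × E) =>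
        ρ.map (measurable_fst (α := E) (β := E)).aemeasurable :=
      ProbabilityMeasure.continuous_map continuous_fst
    have h2 : Continuous fun ρ : ProbabilityMeasure (E × E) =>
        ρ.map (measurable_snd (α := E) (β := E)).aemeasurable :=
      ProbabilityMeasure.continuous_map continuous_snd
    have : K = {ρ | ρ.map (measurable_fst (α := E) (β := E)).aemeasurable = ⟨ν₁, ‹_›⟩} ∩
        {ρ | ρ.map (measurable_snd (α := E) (β := E)).aemeasurable = ⟨ν₂, ‹_›⟩} := by
      ext ρ
      exact ⟨fun h => ⟨Subtype.ext h.1, Subtype.ext h.2⟩,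
        fun h => ⟨congrArg Subtype.val h.1, congrArg Subtype.val h.2⟩⟩
    rw [this]
    exact (isClosed_eq h1 continuous_const).inter (isClosed_eq h2 continuous_const)
  have htight : IsTightMeasureSet {x : Measure (E × E) | ∃ ρ ∈ K, (ρ : Measure (E × E)) = x} := by
    rw [isTightMeasureSet_iff_exists_isCompact_measure_compl_le]
    intro ε hε
    have hε' : 0 < ε / 2 := ENNReal.half_pos hε.ne'
    obtain ⟨K₁, hK₁, h1⟩ := isTightMeasureSet_iff_exists_isCompact_measure_compl_le.1
      (isTightMeasureSet_singleton (μ := ν₁)) _ hε'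
    obtain ⟨K₂, hK₂, h2⟩ := isTightMeasureSet_iff_exists_isCompact_measure_compl_le.1
      (isTightMeasureSet_singleton (μ := ν₂)) _ hε'
    refine ⟨K₁ ×ˢ K₂, hK₁.prod hK₂, ?_⟩
    rintro _ ⟨ρ, hρ, rfl⟩
    have hsub : (K₁ ×ˢ K₂)ᶜ ⊆ (Prod.fst ⁻¹' K₁ᶜ ∪ Prod.snd ⁻¹' K₂ᶜ : Set (E × E)) := by
      rintro ⟨a, b⟩ hab
      simp only [Set.mem_compl_iff, Set.mem_prod, not_and_or] at hab
      exact hab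
    refine (measure_mono hsub).trans ((measure_union_le _ _).trans ?_)
    rw [← Measure.map_apply measurable_fst hK₁.measurableSet.compl,
      ← Measure.map_apply measurable_snd hK₂.measurableSet.compl, hρ.1, hρ.2,
      ← ENNReal.add_halves ε]
    exact add_le_add (h1 _ rfl) (h2 _ rfl)
  have hcompact : IsCompact K := hclosed.closure_eq ▸ isCompact_closure_of_isTightMeasureSet htight
  have hne : K.Nonempty := by
    refine ⟨⟨ν₁.prod ν₂, inferInstance⟩, ?_, ?_⟩
    · change (ν₁.prod ν₂).map Prod.fst = ν₁
      rw [Measure.map_fst_prod, measure_univ, one_smul]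
    · change (ν₁.prod ν₂).map Prod.snd = ν₂
      rw [Measure.map_snd_prod, measure_univ, one_smul]
  obtain ⟨ρ, hρ, hmin⟩ := LowerSemicontinuousOn.exists_isMinOn hne hcompact
    ((lowerSemicontinuous_lintegral_enorm_sub_pow (E := E) p).lowerSemicontinuousOn K)
  refine ⟨ρ, hρ, le_wasserstein_pow hp fun ρ' hρ' => ?_⟩
  exact hmin (show (⟨ρ', hρ'.isProbabilityMeasure⟩ : ProbabilityMeasure (E × E)) ∈ K from hρ')

end OptimalCoupling

section Main

variable {T Ω Ω' : Type*} [MeasurableSpace T] [MeasurableSpace Ω] [MeasurableSpace Ω']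
  {μ : Measure T} {P : Measure Ω} {P' : Measure Ω'} {p : ℕ}

theorem IsQuantileVersion.ae_map_eq [IsProbabilityMeasure P]
    {X : T → Ω → ℝ} {U V : T → Ω' → ℝ}
    (hX : MeasurableProcess X) (hU : IsCopulaProcess P' U)
    (hV : IsQuantileVersion μ P P' X U V) : ∀ᵐ t ∂μ, P'.map (V t) = P.map (X t) := by
  filter_upwards [hV.2] with t ht
  have := Measure.isProbabilityMeasure_map (μ := P) (hX.measurable_eval t).aemeasurable
  rw [Measure.map_congr ht]
  conv_rhs => rw [← map_quantileFn_unif01 (P.map (X t)), ← hU.map_eq t,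
    Measure.map_map (measurable_quantileFn _) (hU.1 t)]
  rfl

theorem lintegral_lintegral_congr_of_ae_map_eq {X : T → Ω → ℝ} {V : T → Ω' → ℝ}
    (hX : MeasurableProcess X) (hV : MeasurableProcess V)
    (h : ∀ᵐ t ∂μ, P'.map (V t) = P.map (X t)) :
    ∫⁻ t, ∫⁻ ω, ‖V t ω‖ₑ ^ p ∂P' ∂μ = ∫⁻ t, ∫⁻ ω, ‖X t ω‖ₑ ^ p ∂P ∂μ := by
  refine lintegral_congr_ae ?_
  filter_upwards [h] with t ht
  have hg : Measurable fun x : ℝ => ‖x‖ₑ ^ p := by fun_prop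
  rw [← lintegral_map hg (hV.measurable_eval t), ht, lintegral_map hg (hX.measurable_eval t)]

variable [Fact (1 ≤ (p : ℝ≥0∞))]

/-- The cost of the quantile coupling is the integral of the Wasserstein distances in time. -/
theorem lintegral_wasserstein_eq_of_isQuantileVersion [IsFiniteMeasure μ] [IsProbabilityMeasure P] [IsProbabilityMeasure P']
    {X Y : T → Ω → ℝ} {U V W : T → Ω' → ℝ}
    (hX : MeasurableProcess X) (hY : MeasurableProcess Y)
    (hXp : ∫⁻ t, ∫⁻ ω, ‖X t ω‖ₑ ^ p ∂P ∂μ < ∞)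
    (hYp : ∫⁻ t, ∫⁻ ω, ‖Y t ω‖ₑ ^ p ∂P ∂μ < ∞) (hU : IsCopulaProcess P' U)
    (hV : IsQuantileVersion μ P P' X U V) (hW : IsQuantileVersion μ P P' Y U W) :
    ∫⁻ t, wasserstein p (P.map (X t)) (P.map (Y t)) ^ p ∂μ =
      ∫⁻ ω, ‖pathClass p μ V ω - pathClass p μ W ω‖ₑ ^ p ∂P' := by
  have hp : 1 ≤ p := one_le_of_one_le_cast Fact.out
  rw [← lintegral_lintegral_congr_of_ae_map_eq hX hV.1 (hV.ae_map_eq hX hU)] at hXp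
  rw [← lintegral_lintegral_congr_of_ae_map_eq hY hW.1 (hW.ae_map_eq hY hU)] at hYp
  rw [lintegral_enorm_pathClass_sub hV.1 hW.1 (ae_memLp_path hV.1 hXp) (ae_memLp_path hW.1 hYp)]
  refine lintegral_congr_ae ?_
  filter_upwards [hV.2, hW.2] with t h1 h2
  have := Measure.isProbabilityMeasure_map (μ := P) (hX.measurable_eval t).aemeasurable
  have := Measure.isProbabilityMeasure_map (μ := P) (hY.measurable_eval t).aemeasurable
  have hg : Measurable fun z : ℝ × ℝ => ‖z.1 - z.2‖ₑ ^ p := by fun_prop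
  have hq := measurable_quantileFn_prodMk (P.map (X t)) (P.map (Y t))
  rw [wasserstein_pow_real _ _ hp, ← lintegral_quantileCoupling _ _ hp, quantileCoupling,
    lintegral_map hg hq, ← hU.map_eq t]
  refine (lintegral_map (hg.comp hq) (hU.1 t)).trans (lintegral_congr_ae ?_)
  filter_upwards [h1, h2] with ω h3 h4
  simp only [Function.comp_apply, h3, h4]

/-- The quantile transform has a measurable version with the right law on `L^p(T)`. -/
theorem exists_isQuantileVersion [MeasurableSpace.CountablyGenerated T] [IsFiniteMeasure μ]
    [IsProbabilityMeasure P] [IsProbabilityMeasure P']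
    {X X' : T → Ω → ℝ} {U : T → Ω' → ℝ}
    (hX : MeasurableProcess X) (hXp : ∫⁻ t, ∫⁻ ω, ‖X t ω‖ₑ ^ p ∂P ∂μ < ∞)
    (hU : IsCopulaProcess P' U) (hrep : IsRepresentative μ P X X')
    (hS : SklarRel (pathLaw P' U) (pathLaw P X')) :
    ∃ V, IsQuantileVersion μ P P' X U V ∧ P'.map (pathClass p μ V) = P.map (pathClass p μ X) := by
  have hX' := hrep.1
  have hXX' := hrep.ae_eq hX
  have hX'p : ∫⁻ t, ∫⁻ ω, ‖X' t ω‖ₑ ^ p ∂P ∂μ < ∞ := by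
    rwa [lintegral_lintegral_congr_of_ae_map_eq hX hX'
      (hXX'.mono fun t ht => Measure.map_congr ht)]
  have := isProbabilityMeasure_pathLaw (P := P) hX'.measurable_eval
  let Z : T → Ω' → ℝ := fun t ω => quantileFn ((pathLaw P X').map fun v => v t) (U t ω)
  have hZ : ∀ t, Measurable (Z t) := fun t => (measurable_quantileFn _).comp (hU.1 t)
  have hlaw : pathLaw P' Z = pathLaw P X' := hS.pathLaw_quantileFn hU
  let T₀ : Set T := {t | ∫⁻ ω, ‖X' t ω‖ₑ ^ p ∂P < ∞}
  have hm : Measurable fun t => ∫⁻ ω, ‖X' t ω‖ₑ ^ p ∂P :=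
    (Measurable.pow_const (Measurable.enorm hX') p).lintegral_prod_right'
  have hT₀ : MeasurableSet T₀ := hm measurableSet_Iio
  have hT₀ae : ∀ᵐ t ∂μ, t ∈ T₀ := ae_lt_top hm hX'p.ne
  classical
  let mask : (T → ℝ) → T → ℝ := fun x t => if t ∈ T₀ then x t else 0
  have hmask : Measurable mask := by
    refine measurable_pi_lambda _ fun t => ?_
    by_cases ht : t ∈ T₀
    · simpa only [mask, if_pos ht] using measurable_pi_apply t
    · simpa only [mask, if_neg ht] using measurable_const
  let X₀ : T → Ω → ℝ := fun t ω => if t ∈ T₀ then X' t ω else 0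
  let Z₀ : T → Ω' → ℝ := fun t ω => if t ∈ T₀ then Z t ω else 0
  have hX₀ : MeasurableProcess X₀ := Measurable.ite (measurable_fst hT₀) hX' measurable_const
  have hZ₀ : ∀ t, Measurable (Z₀ t) := by
    intro t
    by_cases ht : t ∈ T₀
    · simpa only [Z₀, if_pos ht] using hZ t
    · simpa only [Z₀, if_neg ht] using measurable_const
  have hlaw₀ : pathLaw P X₀ = pathLaw P' Z₀ := by
    have h1 : (pathLaw P X').map mask = pathLaw P X₀ :=
      Measure.map_map hmask (measurable_pi_lambda _ hX'.measurable_eval)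
    have h2 : (pathLaw P' Z).map mask = pathLaw P' Z₀ :=
      Measure.map_map hmask (measurable_pi_lambda _ hZ)
    rw [← h1, ← h2, hlaw]
  have hX₀t : ∀ t, ∫⁻ ω, ‖X₀ t ω‖ₑ ^ p ∂P < ∞ := by
    have hp : p ≠ 0 := by have := one_le_of_one_le_cast (p := p) Fact.out; omega
    intro t
    by_cases ht : t ∈ T₀
    · simp only [X₀, if_pos ht]
      exact ht
    · simp [X₀, if_neg ht, hp]
  have hX₀p : ∫⁻ t, ∫⁻ ω, ‖X₀ t ω‖ₑ ^ p ∂P ∂μ < ∞ := by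
    refine lt_of_eq_of_lt (lintegral_congr_ae ?_) hX'p
    filter_upwards [hT₀ae] with t ht
    simp only [X₀, if_pos ht]
  obtain ⟨V, hV, hVZ⟩ := exists_measurable_modification hX₀ hZ₀ hX₀t hlaw₀
  refine ⟨V, ⟨hV, ?_⟩, ?_⟩
  · filter_upwards [hT₀ae, hXX'] with t ht hXt
    filter_upwards [hVZ t] with ω hω
    simp only [hω, Z₀, if_pos ht, Z]
    rw [pathLaw_map_eval hX'.measurable_eval, Measure.map_congr hXt]
  · rw [← map_pathClass_eq_of_pathLaw_eq hX₀ hV hX₀t hX₀p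
      (hlaw₀.trans (pathLaw_congr hV.measurable_eval hZ₀ hVZ).symm)]
    refine Measure.map_congr ?_
    filter_upwards [hrep.2] with ω hω
    refine pathClass_congr ?_
    filter_upwards [hω, hT₀ae] with t h1 h2
    simp only [X₀, if_pos h2, h1]

theorem isRepresentative_evaluation [IsFiniteMeasure μ] [IsProbabilityMeasure P]
    {ev : Lp ℝ (p : ℝ≥0∞) μ → T → ℝ}
    (hev : Measurable (Function.uncurry ev)) (hevφ : ∀ φ, ev φ =ᵐ[μ] φ) {X : T → Ω → ℝ}
    (hX : MeasurableProcess X) (hXp : ∫⁻ t, ∫⁻ ω, ‖X t ω‖ₑ ^ p ∂P ∂μ < ∞) :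
    IsRepresentative μ P X fun t ω => ev (pathClass p μ X ω) t := by
  refine ⟨hev.comp (((measurable_pathClass hX).comp measurable_snd).prodMk measurable_fst), ?_⟩
  filter_upwards [ae_memLp_path hX hXp] with ω hω
  exact (hevφ _).trans (pathClass_ae_eq hω)

/-- The evaluation process on `L^p`, set to zero on a set of times. -/
noncomputable def maskedEvaluation (N : Set T) [DecidablePred (· ∈ N)]
    (ev : Lp ℝ (p : ℝ≥0∞) μ → T → ℝ) (t : T) (φ : Lp ℝ (p : ℝ≥0∞) μ) : ℝ :=
  if t ∈ N then 0 else ev φ t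

theorem measurableProcess_maskedEvaluation {N : Set T} [DecidablePred (· ∈ N)]
    (hN : MeasurableSet N) {ev : Lp ℝ (p : ℝ≥0∞) μ → T → ℝ}
    (hev : Measurable (Function.uncurry ev)) : MeasurableProcess (maskedEvaluation N ev) :=
  Measurable.ite (measurable_fst hN) measurable_const (hev.comp measurable_swap)

theorem isRepresentative_maskedEvaluation [IsFiniteMeasure μ] [IsProbabilityMeasure P]
    {N : Set T} [DecidablePred (· ∈ N)]
    (hN : MeasurableSet N) (hμN : μ N = 0) {ev : Lp ℝ (p : ℝ≥0∞) μ → T → ℝ}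
    (hev : Measurable (Function.uncurry ev)) (hevφ : ∀ φ, ev φ =ᵐ[μ] φ) {X : T → Ω → ℝ}
    (hX : MeasurableProcess X) (hXp : ∫⁻ t, ∫⁻ ω, ‖X t ω‖ₑ ^ p ∂P ∂μ < ∞) :
    IsRepresentative μ P X fun t ω => maskedEvaluation N ev t (pathClass p μ X ω) := by
  refine ⟨(measurableProcess_maskedEvaluation hN hev).comp (measurable_fst.prodMk
    ((measurable_pathClass hX).comp measurable_snd)), ?_⟩
  filter_upwards [(isRepresentative_evaluation hev hevφ hX hXp).2] with ω hω
  filter_upwards [hω, measure_eq_zero_iff_ae_notMem.1 hμN] with t h1 h2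
  rw [maskedEvaluation, if_neg h2, h1]

theorem pathLaw_maskedEvaluation {N : Set T} [DecidablePred (· ∈ N)]
    (hN : MeasurableSet N) {ev : Lp ℝ (p : ℝ≥0∞) μ → T → ℝ}
    (hev : Measurable (Function.uncurry ev)) {φ : Ω → Lp ℝ (p : ℝ≥0∞) μ} (hφ : Measurable φ) :
    pathLaw P (fun t ω => maskedEvaluation N ev t (φ ω)) =
      pathLaw (P.map φ) (maskedEvaluation N ev) :=
  (Measure.map_map (measurable_pi_lambda _
    (measurableProcess_maskedEvaluation hN hev).measurable_eval) hφ).symm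

/-- If a quantile version has the law of `X` on `L^p(T)`, then a representative of `X` has the
given path copula. -/
theorem exists_isRepresentative_sklarRel [MeasurableSpace.CountablyGenerated T] [IsFiniteMeasure μ]
    [IsProbabilityMeasure P] [IsProbabilityMeasure P']
    {X : T → Ω → ℝ} {U V : T → Ω' → ℝ}
    (hX : MeasurableProcess X) (hXp : ∫⁻ t, ∫⁻ ω, ‖X t ω‖ₑ ^ p ∂P ∂μ < ∞)
    (hU : IsCopulaProcess P' U) (hV : IsQuantileVersion μ P P' X U V)
    (hlaw : P'.map (pathClass p μ V) = P.map (pathClass p μ X)) :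
    ∃ X', IsRepresentative μ P X X' ∧ SklarRel (pathLaw P' U) (pathLaw P X') := by
  obtain ⟨ev, hev, hevφ⟩ := exists_measurable_evaluation (p := p) μ
  have hVmap := hV.ae_map_eq hX hU
  have hVp : ∫⁻ t, ∫⁻ ω, ‖V t ω‖ₑ ^ p ∂P' ∂μ < ∞ := by
    rwa [lintegral_lintegral_congr_of_ae_map_eq hX hV.1 hVmap]
  have hgood : ∀ᵐ t ∂μ, ∀ᵐ ω ∂P', ev (pathClass p μ V ω) t =
      quantileFn (P'.map fun ω => ev (pathClass p μ V ω) t) (U t ω) := by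
    filter_upwards [(isRepresentative_evaluation hev hevφ hV.1 hVp).ae_eq hV.1, hV.2, hVmap]
      with t h1 h2 h3
    rw [Measure.map_congr h1, h3]
    filter_upwards [h1, h2] with ω h4 h5
    rw [h4, h5]
  obtain ⟨N, hbad, hN, hμN⟩ := exists_measurable_superset_of_null (ae_iff.1 hgood)
  classical
  refine ⟨_, isRepresentative_maskedEvaluation hN hμN hev hevφ hX hXp, ?_⟩
  rw [pathLaw_maskedEvaluation hN hev (measurable_pathClass hX), ← hlaw,
    ← pathLaw_maskedEvaluation hN hev (measurable_pathClass hV.1)]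
  refine sklarRel_of_ae_eq_quantileFn hU (fun t =>
    ((measurableProcess_maskedEvaluation hN hev).measurable_eval t).comp
      (measurable_pathClass hV.1)) fun t => ?_
  by_cases ht : t ∈ N
  · simp only [maskedEvaluation, if_pos ht, Measure.map_const, measure_univ, one_smul]
    filter_upwards [ae_mem_Ioo_of_map_eq_unif01 (hU.1 t) (hU.map_eq t)] with ω hω
    rw [quantileFn_dirac_zero hω]
  · simp only [maskedEvaluation, if_neg ht]
    exact not_not.1 fun h => ht (hbad h)

theorem IsCoupling.lintegral_eq [IsFiniteMeasure μ]
    {ν₁ ν₂ : Measure (Lp ℝ (p : ℝ≥0∞) μ)}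
    {ρ : Measure (Lp ℝ (p : ℝ≥0∞) μ × Lp ℝ (p : ℝ≥0∞) μ)} [IsProbabilityMeasure ν₁]
    (hρ : IsCoupling ν₁ ν₂ ρ) {ev : Lp ℝ (p : ℝ≥0∞) μ → T → ℝ}
    (hev : Measurable (Function.uncurry ev)) (hevφ : ∀ φ, ev φ =ᵐ[μ] φ) :
    ∫⁻ q, ‖q.1 - q.2‖ₑ ^ p ∂ρ = ∫⁻ t, ∫⁻ q, ‖ev q.1 t - ev q.2 t‖ₑ ^ p ∂ρ ∂μ := by
  have := hρ.isProbabilityMeasure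
  have h1 : Measurable fun z : T × (Lp ℝ (p : ℝ≥0∞) μ × Lp ℝ (p : ℝ≥0∞) μ) => ev z.2.1 z.1 :=
    hev.comp ((measurable_fst.comp measurable_snd).prodMk measurable_fst)
  have h2 : Measurable fun z : T × (Lp ℝ (p : ℝ≥0∞) μ × Lp ℝ (p : ℝ≥0∞) μ) => ev z.2.2 z.1 :=
    hev.comp ((measurable_snd.comp measurable_snd).prodMk measurable_fst)
  rw [lintegral_lintegral_swap ((h1.sub h2).enorm.pow_const p).aemeasurable]
  refine lintegral_congr fun q => ?_
  rw [Lp_enorm_sub_pow (one_le_of_one_le_cast Fact.out)]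
  refine lintegral_congr_ae ?_
  filter_upwards [hevφ q.1, hevφ q.2] with t h3 h4
  rw [h3, h4]

theorem ae_map_evaluation_eq [IsFiniteMeasure μ] [IsProbabilityMeasure P]
    {ev : Lp ℝ (p : ℝ≥0∞) μ → T → ℝ}
    (hev : Measurable (Function.uncurry ev)) (hevφ : ∀ φ, ev φ =ᵐ[μ] φ) {X : T → Ω → ℝ}
    (hX : MeasurableProcess X) (hXp : ∫⁻ t, ∫⁻ ω, ‖X t ω‖ₑ ^ p ∂P ∂μ < ∞) :
    ∀ᵐ t ∂μ, (P.map (pathClass p μ X)).map (fun φ => ev φ t) = P.map (X t) := by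
  filter_upwards [(isRepresentative_evaluation hev hevφ hX hXp).ae_eq hX] with t ht
  have hevt : Measurable fun φ => ev φ t := hev.comp measurable_prodMk_right
  rw [Measure.map_map hevt (measurable_pathClass hX)]
  exact Measure.map_congr ht

/-- At almost every time, a coupling on `L^p(T)` yields a coupling of the marginals. -/
theorem IsCoupling.ae_isCoupling_evaluation [IsFiniteMeasure μ] [IsProbabilityMeasure P]
    {X Y : T → Ω → ℝ}
    (hX : MeasurableProcess X) (hY : MeasurableProcess Y)
    (hXp : ∫⁻ t, ∫⁻ ω, ‖X t ω‖ₑ ^ p ∂P ∂μ < ∞)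
    (hYp : ∫⁻ t, ∫⁻ ω, ‖Y t ω‖ₑ ^ p ∂P ∂μ < ∞)
    {ρ : Measure (Lp ℝ (p : ℝ≥0∞) μ × Lp ℝ (p : ℝ≥0∞) μ)}
    (hρ : IsCoupling (P.map (pathClass p μ X)) (P.map (pathClass p μ Y)) ρ)
    {ev : Lp ℝ (p : ℝ≥0∞) μ → T → ℝ}
    (hev : Measurable (Function.uncurry ev)) (hevφ : ∀ φ, ev φ =ᵐ[μ] φ) :
    ∀ᵐ t ∂μ, IsCoupling (P.map (X t)) (P.map (Y t)) (ρ.map fun q => (ev q.1 t, ev q.2 t)) := by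
  filter_upwards [ae_map_evaluation_eq hev hevφ hX hXp, ae_map_evaluation_eq hev hevφ hY hYp]
    with t h1 h2
  have hevt : Measurable fun φ => ev φ t := hev.comp measurable_prodMk_right
  have hpair : Measurable fun q : Lp ℝ (p : ℝ≥0∞) μ × Lp ℝ (p : ℝ≥0∞) μ =>
      (ev q.1 t, ev q.2 t) := (hevt.comp measurable_fst).prodMk (hevt.comp measurable_snd)
  constructor
  · rw [Measure.map_map measurable_fst hpair, ← h1, ← hρ.1, Measure.map_map hevt measurable_fst]
    rfl
  · rw [Measure.map_map measurable_snd hpair, ← h2, ← hρ.2, Measure.map_map hevt measurable_snd]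
    rfl

theorem lintegral_map_evaluation {ev : Lp ℝ (p : ℝ≥0∞) μ → T → ℝ}
    (hev : Measurable (Function.uncurry ev))
    (ρ : Measure (Lp ℝ (p : ℝ≥0∞) μ × Lp ℝ (p : ℝ≥0∞) μ)) (t : T) :
    ∫⁻ z, ‖z.1 - z.2‖ₑ ^ p ∂ρ.map (fun q => (ev q.1 t, ev q.2 t)) =
      ∫⁻ q, ‖ev q.1 t - ev q.2 t‖ₑ ^ p ∂ρ := by
  have hevt : Measurable fun φ => ev φ t := hev.comp measurable_prodMk_right
  exact lintegral_map (f := fun z : ℝ × ℝ => ‖z.1 - z.2‖ₑ ^ p) (by fun_prop)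
    ((hevt.comp measurable_fst).prodMk (hevt.comp measurable_snd))

theorem lintegral_wasserstein_le [MeasurableSpace.CountablyGenerated T] [IsFiniteMeasure μ]
    [IsProbabilityMeasure P]
    {X Y : T → Ω → ℝ}
    (hX : MeasurableProcess X) (hY : MeasurableProcess Y)
    (hXp : ∫⁻ t, ∫⁻ ω, ‖X t ω‖ₑ ^ p ∂P ∂μ < ∞)
    (hYp : ∫⁻ t, ∫⁻ ω, ‖Y t ω‖ₑ ^ p ∂P ∂μ < ∞) :
    ∫⁻ t, wasserstein p (P.map (X t)) (P.map (Y t)) ^ p ∂μ ≤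
      wasserstein p (P.map (pathClass p μ X)) (P.map (pathClass p μ Y)) ^ p := by
  have hp : 1 ≤ p := one_le_of_one_le_cast Fact.out
  obtain ⟨ev, hev, hevφ⟩ := exists_measurable_evaluation (p := p) μ
  have := Measure.isProbabilityMeasure_map (μ := P)
    (measurable_pathClass (p := p) (μ := μ) hX).aemeasurable
  refine le_wasserstein_pow hp fun ρ hρ => ?_
  rw [hρ.lintegral_eq hev hevφ]
  refine lintegral_mono_ae ?_
  filter_upwards [hρ.ae_isCoupling_evaluation hX hY hXp hYp hev hevφ] with t ht
  rw [← lintegral_map_evaluation hev]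
  exact wasserstein_pow_le hp ht

theorem wasserstein_pathClass_pow_ne_top [IsFiniteMeasure μ] [IsProbabilityMeasure P]
    {X Y : T → Ω → ℝ}
    (hX : MeasurableProcess X) (hY : MeasurableProcess Y)
    (hXp : ∫⁻ t, ∫⁻ ω, ‖X t ω‖ₑ ^ p ∂P ∂μ < ∞)
    (hYp : ∫⁻ t, ∫⁻ ω, ‖Y t ω‖ₑ ^ p ∂P ∂μ < ∞) :
    wasserstein p (P.map (pathClass p μ X)) (P.map (pathClass p μ Y)) ^ p ≠ ∞ := by
  have hp : 1 ≤ p := one_le_of_one_le_cast Fact.out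
  have hXc := measurable_pathClass (p := p) (μ := μ) hX
  have hYc := measurable_pathClass (p := p) (μ := μ) hY
  have hcoup : IsCoupling (P.map (pathClass p μ X)) (P.map (pathClass p μ Y))
      (P.map fun ω => (pathClass p μ X ω, pathClass p μ Y ω)) :=
    ⟨Measure.map_map measurable_fst (hXc.prodMk hYc),
      Measure.map_map measurable_snd (hXc.prodMk hYc)⟩
  have hXY : Measurable fun q : T × Ω => X q.1 q.2 - Y q.1 q.2 := Measurable.sub hX hY
  have hfin : ∫⁻ t, ∫⁻ ω, ‖X t ω - Y t ω‖ₑ ^ p ∂P ∂μ < ∞ := by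
    rw [← lintegral_prod (fun q : T × Ω => ‖X q.1 q.2‖ₑ ^ p)
      (Measurable.pow_const (Measurable.enorm hX) p).aemeasurable, ← memLp_natCast_iff hp hX] at hXp
    rw [← lintegral_prod (fun q : T × Ω => ‖Y q.1 q.2‖ₑ ^ p)
      (Measurable.pow_const (Measurable.enorm hY) p).aemeasurable, ← memLp_natCast_iff hp hY] at hYp
    rw [← lintegral_prod (fun q : T × Ω => ‖X q.1 q.2 - Y q.1 q.2‖ₑ ^ p)
      (hXY.enorm.pow_const p).aemeasurable, ← memLp_natCast_iff hp hXY]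
    exact hXp.sub hYp
  refine ne_top_of_le_ne_top hfin.ne ?_
  rw [← lintegral_enorm_pathClass_sub hX hY (ae_memLp_path hX hXp) (ae_memLp_path hY hYp)]
  exact (wasserstein_pow_le hp hcoup).trans (lintegral_map_le _ _)

/-- The integral formula forces a common path copula if `p ≥ 2`. -/
theorem exists_sharePathCopula_of_integralFormula [MeasurableSpace.CountablyGenerated T] [IsFiniteMeasure μ]
    [IsProbabilityMeasure P]
    (hp : 2 ≤ p) {X Y : T → Ω → ℝ}
    (hX : MeasurableProcess X) (hY : MeasurableProcess Y)
    (hXp : ∫⁻ t, ∫⁻ ω, ‖X t ω‖ₑ ^ p ∂P ∂μ < ∞)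
    (hYp : ∫⁻ t, ∫⁻ ω, ‖Y t ω‖ₑ ^ p ∂P ∂μ < ∞)
    (h : WassersteinIntegralFormula p μ P X Y) :
    ∃ C : Measure (T → ℝ), IsCopulaMeasure C ∧ SharePathCopula μ P X Y C := by
  have hp' : 1 ≤ p := one_le_of_one_le_cast Fact.out
  have : Fact ((p : ℝ≥0∞) ≠ ∞) := ⟨ENNReal.natCast_ne_top p⟩
  have hXc := measurable_pathClass (p := p) (μ := μ) hX
  have hYc := measurable_pathClass (p := p) (μ := μ) hY
  have := Measure.isProbabilityMeasure_map (μ := P) hXc.aemeasurable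
  have := Measure.isProbabilityMeasure_map (μ := P) hYc.aemeasurable
  obtain ⟨ev, hev, hevφ⟩ := exists_measurable_evaluation (p := p) μ
  have hevt : ∀ t, Measurable fun φ => ev φ t := fun t => hev.comp measurable_prodMk_right
  obtain ⟨ρ, hρ, hopt⟩ := exists_coupling_le_wasserstein hp'
    (P.map (pathClass p μ X)) (P.map (pathClass p μ Y))
  have := hρ.isProbabilityMeasure
  have hfin := wasserstein_pathClass_pow_ne_top (p := p) hX hY hXp hYp
  have hcoup := hρ.ae_isCoupling_evaluation hX hY hXp hYp hev hevφ
  rw [h, hρ.lintegral_eq hev hevφ] at hopt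
  rw [h] at hfin
  have hcm : Measurable fun t => ∫⁻ q, ‖ev q.1 t - ev q.2 t‖ₑ ^ p ∂ρ := by
    have h1 : Measurable fun z : T × (Lp ℝ (p : ℝ≥0∞) μ × Lp ℝ (p : ℝ≥0∞) μ) => ev z.2.1 z.1 :=
      hev.comp ((measurable_fst.comp measurable_snd).prodMk measurable_fst)
    have h2 : Measurable fun z : T × (Lp ℝ (p : ℝ≥0∞) μ × Lp ℝ (p : ℝ≥0∞) μ) => ev z.2.2 z.1 :=
      hev.comp ((measurable_snd.comp measurable_snd).prodMk measurable_fst)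
    exact ((h1.sub h2).enorm.pow_const p).lintegral_prod_right'
  have heq := ae_eq_of_ae_le_of_lintegral_le (by
    filter_upwards [hcoup] with t ht
    have hle := wasserstein_pow_le hp' ht
    rwa [lintegral_map_evaluation hev] at hle) hfin hcm.aemeasurable hopt
  have hpair : ∀ t, Measurable fun q : Lp ℝ (p : ℝ≥0∞) μ × Lp ℝ (p : ℝ≥0∞) μ =>
      (ev q.1 t, ev q.2 t) := fun t =>
    ((hevt t).comp measurable_fst).prodMk ((hevt t).comp measurable_snd)
  have hgood : ∀ᵐ t ∂μ, ρ.map (fun q => (ev q.1 t, ev q.2 t)) =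
      quantileCoupling (ρ.map fun q => ev q.1 t) (ρ.map fun q => ev q.2 t) := by
    filter_upwards [hcoup, heq, ae_lt_top hcm (ne_top_of_le_ne_top hfin hopt)] with t h1 h2 h3
    have := Measure.isProbabilityMeasure_map (μ := P) (hX.measurable_eval t).aemeasurable
    have := Measure.isProbabilityMeasure_map (μ := P) (hY.measurable_eval t).aemeasurable
    have := Measure.isProbabilityMeasure_map (μ := ρ) (hpair t).aemeasurable
    have hunique := eq_quantileCoupling_of_optimal
      (π := ρ.map fun q => (ev q.1 t, ev q.2 t)) hp
      (by rw [lintegral_map_evaluation hev]; exact h3.ne)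
      (by rw [lintegral_map_evaluation hev, ← h2, wasserstein_pow_real _ _ hp', h1.1, h1.2])
    rw [Measure.map_map measurable_fst (hpair t), Measure.map_map measurable_snd (hpair t)]
      at hunique
    exact hunique
  obtain ⟨N, hbad, hN, hμN⟩ := exists_measurable_superset_of_null (ae_iff.1 hgood)
  classical
  have hE := (measurableProcess_maskedEvaluation hN hev).measurable_eval
  obtain ⟨C, hC, hCX, hCY⟩ := exists_common_copula_of_comonotone ρ
    (A := fun t q => maskedEvaluation N ev t q.1) (B := fun t q => maskedEvaluation N ev t q.2)
    (fun t => (hE t).comp measurable_fst) (fun t => (hE t).comp measurable_snd) (by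
      intro t
      by_cases ht : t ∈ N
      · simp only [maskedEvaluation, if_pos ht]
        exact map_zero_prodMk_eq_quantileCoupling ρ
      · simp only [maskedEvaluation, if_neg ht]
        exact not_not.1 fun h => ht (hbad h))
  rw [pathLaw_maskedEvaluation hN hev measurable_fst, hρ.1,
    ← pathLaw_maskedEvaluation hN hev hXc] at hCX
  rw [pathLaw_maskedEvaluation hN hev measurable_snd, hρ.2,
    ← pathLaw_maskedEvaluation hN hev hYc] at hCY
  exact ⟨C, hC, _, _, isRepresentative_maskedEvaluation hN hμN hev hevφ hX hXp,
    isRepresentative_maskedEvaluation hN hμN hev hevφ hY hYp, hCX, hCY⟩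

/-- A common path copula makes the quantile coupling optimal. -/
theorem SharePathCopula.quantileCouplingOptimal [MeasurableSpace.CountablyGenerated T]
    [IsFiniteMeasure μ] [IsProbabilityMeasure P] [IsProbabilityMeasure P']
    {X Y : T → Ω → ℝ} {U : T → Ω' → ℝ}
    (hX : MeasurableProcess X) (hY : MeasurableProcess Y)
    (hXp : ∫⁻ t, ∫⁻ ω, ‖X t ω‖ₑ ^ p ∂P ∂μ < ∞)
    (hYp : ∫⁻ t, ∫⁻ ω, ‖Y t ω‖ₑ ^ p ∂P ∂μ < ∞) (hU : IsCopulaProcess P' U)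
    (h : SharePathCopula μ P X Y (pathLaw P' U)) :
    QuantileCouplingOptimal p μ P P' X Y U ∧ WassersteinIntegralFormula p μ P X Y := by
  have hp : 1 ≤ p := one_le_of_one_le_cast Fact.out
  have : Fact ((p : ℝ≥0∞) ≠ ∞) := ⟨ENNReal.natCast_ne_top p⟩
  obtain ⟨X', Y', hrX, hrY, hSX, hSY⟩ := h
  obtain ⟨V, hV, hVlaw⟩ := exists_isQuantileVersion hX hXp hU hrX hSX
  obtain ⟨W, hW, hWlaw⟩ := exists_isQuantileVersion hY hYp hU hrY hSY
  have hVc := measurable_pathClass (p := p) (μ := μ) hV.1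
  have hWc := measurable_pathClass (p := p) (μ := μ) hW.1
  have hcoup : IsCoupling (P.map (pathClass p μ X)) (P.map (pathClass p μ Y))
      (P'.map fun ω => (pathClass p μ V ω, pathClass p μ W ω)) :=
    ⟨(Measure.map_map measurable_fst (hVc.prodMk hWc)).trans hVlaw,
      (Measure.map_map measurable_snd (hVc.prodMk hWc)).trans hWlaw⟩
  have hcost : ∫⁻ q, ‖q.1 - q.2‖ₑ ^ p ∂(P'.map fun ω => (pathClass p μ V ω, pathClass p μ W ω)) ≤
      ∫⁻ t, wasserstein p (P.map (X t)) (P.map (Y t)) ^ p ∂μ := by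
    rw [lintegral_wasserstein_eq_of_isQuantileVersion hX hY hXp hYp hU hV hW]
    exact lintegral_map_le _ _
  have hlow := lintegral_wasserstein_le hX hY hXp hYp
  refine ⟨⟨V, W, hV, hW, hcoup, le_antisymm ?_ (iInf₂_le _ hcoup)⟩,
    le_antisymm ((wasserstein_pow_le hp hcoup).trans hcost) hlow⟩
  refine (ENNReal.pow_right_strictMono (by omega : p ≠ 0)).le_iff_le.1 ?_
  change transportCost p _ ^ p ≤ wasserstein p _ _ ^ p
  rw [transportCost, rpow_one_div_pow hp]
  exact hcost.trans hlow

theorem QuantileCouplingOptimal.sharePathCopula [MeasurableSpace.CountablyGenerated T]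
    [IsFiniteMeasure μ] [IsProbabilityMeasure P] [IsProbabilityMeasure P']
    {X Y : T → Ω → ℝ} {U : T → Ω' → ℝ}
    (hX : MeasurableProcess X) (hY : MeasurableProcess Y)
    (hXp : ∫⁻ t, ∫⁻ ω, ‖X t ω‖ₑ ^ p ∂P ∂μ < ∞)
    (hYp : ∫⁻ t, ∫⁻ ω, ‖Y t ω‖ₑ ^ p ∂P ∂μ < ∞) (hU : IsCopulaProcess P' U)
    (h : QuantileCouplingOptimal p μ P P' X Y U) :
    SharePathCopula μ P X Y (pathLaw P' U) := by
  obtain ⟨V, W, hV, hW, ⟨h1, h2⟩, -⟩ := h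
  have hVW := (measurable_pathClass (p := p) (μ := μ) hV.1).prodMk
    (measurable_pathClass (p := p) (μ := μ) hW.1)
  rw [Measure.map_map measurable_fst hVW] at h1
  rw [Measure.map_map measurable_snd hVW] at h2
  obtain ⟨X', hrX, hSX⟩ := exists_isRepresentative_sklarRel hX hXp hU hV h1
  obtain ⟨Y', hrY, hSY⟩ := exists_isRepresentative_sklarRel hY hYp hU hW h2
  exact ⟨X', Y', hrX, hrY, hSX, hSY⟩

end Main

theorem copula_optimal_coupling_Lp
    {d : ℕ} (T : Set (Fin d → ℝ)) (hT : IsCompact T)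
    (μ : Measure T) [IsFiniteMeasure μ]
    (p : ℕ) [Fact (1 ≤ (p : ℝ≥0∞))]
    {Ω : Type*} [MeasurableSpace Ω] (P : Measure Ω) [IsProbabilityMeasure P]
    (X Y : T → Ω → ℝ) (hX : MeasurableProcess X) (hY : MeasurableProcess Y)
    (hXp : ∫⁻ t, ∫⁻ ω, ‖X t ω‖ₑ ^ p ∂P ∂μ < ∞)
    (hYp : ∫⁻ t, ∫⁻ ω, ‖Y t ω‖ₑ ^ p ∂P ∂μ < ∞) :
    -- (i) ↔ (ii), for every copula process `U` (with law `C`)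
    (∀ {Ω' : Type*} [MeasurableSpace Ω'] (P' : Measure Ω') [IsProbabilityMeasure P']
        (U : T → Ω' → ℝ), IsCopulaProcess P' U →
      (SharePathCopula μ P X Y (pathLaw P' U) ↔ QuantileCouplingOptimal p μ P P' X Y U)) ∧
    -- (i) → (iii)
    ((∃ C : Measure (T → ℝ), IsCopulaMeasure C ∧ SharePathCopula μ P X Y C) →
      WassersteinIntegralFormula p μ P X Y) ∧
    -- (iii) → (i)
    (2 ≤ p → WassersteinIntegralFormula p μ P X Y →
      ∃ C : Measure (T → ℝ), IsCopulaMeasure C ∧ SharePathCopula μ P X Y C) ∧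
    -- the common value
    (∀ {Ω' : Type*} [MeasurableSpace Ω'] (P' : Measure Ω') [IsProbabilityMeasure P']
        (U : T → Ω' → ℝ), IsCopulaProcess P' U → SharePathCopula μ P X Y (pathLaw P' U) →
      ∀ V W : T → Ω' → ℝ, IsQuantileVersion μ P P' X U V → IsQuantileVersion μ P P' Y U W →
        ∫⁻ t, wasserstein p (P.map (X t)) (P.map (Y t)) ^ p ∂μ =
          ∫⁻ ω, ‖pathClass p μ V ω - pathClass p μ W ω‖ₑ ^ p ∂P') := by
  refine ⟨fun P' _ U hU => ⟨fun h => (h.quantileCouplingOptimal hX hY hXp hYp hU).1,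
    fun h => h.sharePathCopula hX hY hXp hYp hU⟩, ?_,
    fun hp h => exists_sharePathCopula_of_integralFormula hp hX hY hXp hYp h,
    fun P' _ U hU _ V W hV hW =>
      lintegral_wasserstein_eq_of_isQuantileVersion hX hY hXp hYp hU hV hW⟩
  rintro ⟨C, hC, h⟩
  have := hC.1
  have hlaw : pathLaw C (fun (t : T) u => u t) = C := Measure.map_id
  have hU : IsCopulaProcess C (fun (t : T) u => u t) :=
    ⟨fun t => measurable_pi_apply t, by rwa [hlaw]⟩
  rw [← hlaw] at h
  exact (h.quantileCouplingOptimal hX hY hXp hYp hU).2
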